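/- Assume ν > −1/2. There exists a constant C such that for all t > 0 and x, y ∈ (0,1), |∂𝒫_t(x,y)/∂x| ≤ C (xy)^{−ν−1/2} / (t² + |x−y|²). -/

import Mathlib

open MeasureTheory Real Set Filter Topology
open scoped ENNReal NNReal

/-- Bessel function of the first kind of order `ν` (defined by its power series). -/
noncomputable def besselJ (ν x : ℝ) : ℝ :=
  ∑' m : ℕ, ((-1 : ℝ) ^ m / ((m.factorial : ℝ) * Real.Gamma ((m : ℝ) + ν + 1))) *
    (x / 2) ^ (2 * (m : ℝ) + ν)

/-- `Λ` enumerates the successive positive zeros of `J_ν`, in increasing order,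
`Λ n` corresponding to `λ_{n+1,ν}`. -/
def IsPositiveZerosOfBesselJ (ν : ℝ) (Λ : ℕ → ℝ) : Prop :=
  StrictMono Λ ∧ (∀ n, 0 < Λ n) ∧ (∀ n, besselJ ν (Λ n) = 0) ∧
    ∀ x : ℝ, 0 < x → besselJ ν x = 0 → ∃ n, Λ n = x

/-- The eigenfunctions `φ_n^ν`. -/
noncomputable def phiFB (ν : ℝ) (Λ : ℕ → ℝ) (n : ℕ) (x : ℝ) : ℝ :=
  (Real.sqrt 2 / |Λ n * besselJ (ν + 1) (Λ n)|) * Real.sqrt (Λ n) *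
    besselJ ν (Λ n * x) * x ^ (-ν)

/-- The Fourier–Bessel Poisson kernel `𝒫_t(x,y)`. -/
noncomputable def pKer (ν : ℝ) (Λ : ℕ → ℝ) (t x y : ℝ) : ℝ :=
  ∑' n : ℕ, Real.exp (-t * Λ n) * phiFB ν Λ n x * phiFB ν Λ n y

/-- The kernel `P_t(x,y) = (xy)^{ν+1/2} 𝒫_t(x,y)`. -/
noncomputable def pKerL (ν : ℝ) (Λ : ℕ → ℝ) (t x y : ℝ) : ℝ :=
  (x * y) ^ (ν + 1/2) * pKer ν Λ t x y

/-- The measure `dμ(x) = x^{2ν+1} dx` on `(0,1)`. -/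
noncomputable def muMeas (ν : ℝ) : Measure ℝ :=
  (volume.restrict (Ioo 0 1)).withDensity fun x => ENNReal.ofReal (x ^ (2 * ν + 1))

noncomputable def pI (j : ℕ) : ℝ := 1 - (1/2 : ℝ) ^ j
noncomputable def qI (j : ℕ) : ℝ := 1 - (1/2 : ℝ) ^ (j + 1)

/-- The `s`-dilate (same center, `s` times the length) of `(p,q]`, intersected with `(0,1)`. -/
def starSet (s p q : ℝ) : Set ℝ :=
  Ioc ((p + q)/2 - s * (q - p)/2) ((p + q)/2 + s * (q - p)/2) ∩ Ioo 0 1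

noncomputable def Istar (j : ℕ) : Set ℝ := starSet (51/50) (pI j) (qI j)
noncomputable def Istar2 (j : ℕ) : Set ℝ := starSet ((51/50)^2) (pI j) (qI j)

noncomputable def pJ (j : ℤ) : ℝ := if 1 ≤ j then 1 - (2:ℝ) ^ (-j) else (2:ℝ) ^ (j - 1)
noncomputable def qJ (j : ℤ) : ℝ := if 1 ≤ j then 1 - (2:ℝ) ^ (-j - 1) else (2:ℝ) ^ j

noncomputable def Jstar (j : ℤ) : Set ℝ := starSet (51/50) (pJ j) (qJ j)
noncomputable def Jstar2 (j : ℤ) : Set ℝ := starSet ((51/50)^2) (pJ j) (qJ j)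

/-- Modified Bessel function of the first kind. -/
noncomputable def besselI (ν x : ℝ) : ℝ :=
  ∑' m : ℕ, (1 / ((m.factorial : ℝ) * Real.Gamma ((m : ℝ) + ν + 1))) *
    (x / 2) ^ (2 * (m : ℝ) + ν)

/-- The Bessel heat kernel `𝐓_t(x,y)` on `(0,∞)`. -/
noncomputable def bHeatKer (ν t x y : ℝ) : ℝ :=
  (2*t)⁻¹ * Real.exp (-(x^2 + y^2)/(4*t)) * besselI ν (x*y/(2*t)) * (x*y) ^ (-ν)

/-- The Fourier–Bessel heat kernel `𝒯_t(x,y)` on `(0,1)`. -/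
noncomputable def fbHeatKer (ν : ℝ) (Λ : ℕ → ℝ) (t x y : ℝ) : ℝ :=
  ∑' n : ℕ, Real.exp (-t * (Λ n)^2) * phiFB ν Λ n x * phiFB ν Λ n y

/-- The entire function `s ↦ ∑ (-s)^m / (m! Γ(m+μ+1))`, so that
`J_μ(x) = (x/2)^μ * besselEntire μ (x²/4)` for `x > 0`. -/
noncomputable def besselEntire (μ s : ℝ) : ℝ :=
  ∑' m : ℕ, ((-1 : ℝ) ^ m / ((m.factorial : ℝ) * Real.Gamma ((m : ℝ) + μ + 1))) * s ^ m

lemma exists_lower_bound_Gamma {μ : ℝ} (hμ : -1 < μ) :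
    ∃ K : ℝ, 0 < K ∧ ∀ m : ℕ, K ≤ Real.Gamma ((m : ℝ) + μ + 1) := by
  have h1 : 0 < Real.Gamma (μ + 1) := Real.Gamma_pos_of_pos (by linarith)
  have h2 : 0 < Real.Gamma (μ + 2) := Real.Gamma_pos_of_pos (by linarith)
  have key : ∀ m : ℕ, Real.Gamma (μ + 2) ≤ Real.Gamma ((m : ℝ) + 1 + μ + 1) := by
    intro m
    induction m with
    | zero => apply le_of_eq; congr 1; push_cast; ring
    | succ m ih =>
      have hm : (0 : ℝ) ≤ m := m.cast_nonneg
      have e : ((m + 1 : ℕ) : ℝ) + 1 + μ + 1 = ((m : ℝ) + 1 + μ + 1) + 1 := by push_cast; ring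
      rw [e, Real.Gamma_add_one (by linarith)]
      nlinarith
  refine ⟨min (Real.Gamma (μ + 1)) (Real.Gamma (μ + 2)), lt_min h1 h2, ?_⟩
  rintro (_ | m)
  · simp
  · refine (min_le_right _ _).trans ?_
    simpa using key m

lemma exists_besselEntire_coeff_bound {μ : ℝ} (hμ : -1 < μ) :
    ∃ K : ℝ, 0 < K ∧ ∀ m : ℕ,
      |(-1 : ℝ) ^ m / ((m.factorial : ℝ) * Real.Gamma ((m : ℝ) + μ + 1))| ≤ K / m.factorial := by
  obtain ⟨K, hK, h⟩ := exists_lower_bound_Gamma hμ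
  refine ⟨K⁻¹, inv_pos.2 hK, fun m => ?_⟩
  have hm : (0 : ℝ) < m.factorial := by positivity
  have hG : 0 < Real.Gamma ((m : ℝ) + μ + 1) := hK.trans_le (h m)
  rw [abs_div, abs_pow, abs_neg, abs_one, one_pow, abs_of_pos (mul_pos hm hG), div_eq_mul_inv,
    mul_inv, one_mul, mul_comm, div_eq_mul_inv]
  gcongr
  exact h m

lemma summable_besselEntire {μ : ℝ} (hμ : -1 < μ) (s : ℝ) :
    Summable fun m : ℕ =>
      ((-1 : ℝ) ^ m / ((m.factorial : ℝ) * Real.Gamma ((m : ℝ) + μ + 1))) * s ^ m := by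
  obtain ⟨K, hK, h⟩ := exists_besselEntire_coeff_bound hμ
  refine Summable.of_norm_bounded ((Real.summable_pow_div_factorial |s|).mul_left K) fun m => ?_
  rw [norm_mul, norm_pow, Real.norm_eq_abs, Real.norm_eq_abs]
  calc _ ≤ K / m.factorial * |s| ^ m := by gcongr; exact h m
    _ = _ := by ring

lemma hasDerivAt_besselEntire {μ : ℝ} (hμ : -1 < μ) (s : ℝ) :
    HasDerivAt (besselEntire μ) (-besselEntire (μ + 1) s) s := by
  obtain ⟨K, hK, h⟩ := exists_besselEntire_coeff_bound hμ
  set a : ℕ → ℝ := fun m => (-1 : ℝ) ^ m / ((m.factorial : ℝ) * Real.Gamma ((m : ℝ) + μ + 1))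
    with ha
  set R := |s| + 1 with hR
  have hR0 : 0 < R := by positivity
  have key : ∀ m : ℕ, a (m + 1) * (m + 1) =
      -((-1 : ℝ) ^ m / ((m.factorial : ℝ) * Real.Gamma ((m : ℝ) + (μ + 1) + 1))) := by
    intro m
    have e : ((m + 1 : ℕ) : ℝ) + μ + 1 = (m : ℝ) + (μ + 1) + 1 := by push_cast; ring
    have hm : (m : ℝ) + 1 ≠ 0 := by positivity
    simp only [ha]
    rw [e, Nat.factorial_succ, pow_succ]
    push_cast
    have hG : Real.Gamma ((m : ℝ) + (μ + 1) + 1) ≠ 0 :=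
      (Real.Gamma_pos_of_pos (by have : (0:ℝ) ≤ m := m.cast_nonneg
                                 linarith)).ne'
    field_simp
  have hu : Summable fun m : ℕ => K * (m / m.factorial * R ^ (m - 1)) := by
    refine Summable.mul_left K ((summable_nat_add_iff 1).1
      ((Real.summable_pow_div_factorial R).congr fun m => ?_))
    have hm : (m : ℝ) + 1 ≠ 0 := by positivity
    rw [Nat.factorial_succ]
    push_cast
    field_simp
  have := hasDerivAt_tsum_of_isPreconnected (𝕜 := ℝ) (t := Metric.ball (0 : ℝ) R) (y₀ := s) (y := s)
    (g := fun m x => a m * x ^ m) (g' := fun m x => a m * (m * x ^ (m - 1))) hu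
    Metric.isOpen_ball (convex_ball (0 : ℝ) R).isPreconnected
    (fun m x _ => (hasDerivAt_pow m x).const_mul (a m)) ?_ (by simp [hR])
    (summable_besselEntire hμ s) (by simp [hR])
  · refine this.congr_deriv ?_
    rw [Summable.tsum_eq_zero_add, besselEntire, ← tsum_neg]
    · simp only [Nat.cast_zero, zero_mul, mul_zero, zero_add]
      refine tsum_congr fun m => ?_
      rw [← neg_mul, ← key m]
      simp only [Nat.add_sub_cancel]
      push_cast
      ring
    · refine (summable_nat_add_iff 1).1
        ((summable_besselEntire (μ := μ + 1) (by linarith) s).neg.congr fun m => ?_)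
      rw [← neg_mul, ← key m]
      simp only [Nat.add_sub_cancel]
      push_cast
      ring
  · intro m x hx
    have hx' : |x| ≤ R := by simpa using (mem_ball_zero_iff.1 hx).le
    rw [norm_mul, norm_mul, norm_pow, Real.norm_eq_abs, Real.norm_eq_abs, Real.norm_eq_abs,
      Nat.abs_cast]
    calc _ ≤ K / m.factorial * (m * R ^ (m - 1)) := by gcongr; exact h m
      _ = _ := by ring

lemma besselEntire_recurrence {μ : ℝ} (hμ : -1 < μ) (s : ℝ) :
    besselEntire μ s = (μ + 1) * besselEntire (μ + 1) s - s * besselEntire (μ + 2) s := by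
  have h0 := summable_besselEntire hμ s
  have h1 := summable_besselEntire (μ := μ + 1) (by linarith) s
  have h2 := summable_besselEntire (μ := μ + 2) (by linarith) s
  have hs : Summable fun m : ℕ => (m : ℝ) *
      (((-1 : ℝ) ^ m / ((m.factorial : ℝ) * Real.Gamma ((m : ℝ) + (μ + 1) + 1))) * s ^ m) := by
    refine (h0.sub (h1.mul_left (μ + 1))).congr fun m => ?_
    have hm : (0:ℝ) ≤ m := m.cast_nonneg
    have e : (m : ℝ) + (μ + 1) + 1 = ((m : ℝ) + μ + 1) + 1 := by ring
    have hp : (m : ℝ) + μ + 1 ≠ 0 := by linarith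
    have hG : Real.Gamma ((m : ℝ) + μ + 1) ≠ 0 := (Real.Gamma_pos_of_pos (by linarith)).ne'
    rw [e, Real.Gamma_add_one hp]
    field_simp
    ring
  have e2 : ∑' m : ℕ, (m : ℝ) *
      (((-1 : ℝ) ^ m / ((m.factorial : ℝ) * Real.Gamma ((m : ℝ) + (μ + 1) + 1))) * s ^ m) =
      - (s * besselEntire (μ + 2) s) := by
    rw [Summable.tsum_eq_zero_add hs, besselEntire, ← tsum_mul_left, ← tsum_neg]
    simp only [Nat.cast_zero, zero_mul, zero_add]
    refine tsum_congr fun m => ?_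
    have hm : (m : ℝ) + 1 ≠ 0 := by positivity
    have e : ((m + 1 : ℕ) : ℝ) + (μ + 1) + 1 = (m : ℝ) + (μ + 2) + 1 := by push_cast; ring
    rw [e, Nat.factorial_succ]
    have hG : Real.Gamma ((m : ℝ) + (μ + 2) + 1) ≠ 0 :=
      (Real.Gamma_pos_of_pos (by have : (0:ℝ) ≤ m := m.cast_nonneg
                                 linarith)).ne'
    push_cast
    field_simp
    ring
  rw [sub_eq_add_neg, ← e2]
  simp only [besselEntire]
  rw [← tsum_mul_left, ← Summable.tsum_add (h1.mul_left _) hs]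
  refine tsum_congr fun m => ?_
  have hm : (0:ℝ) ≤ m := m.cast_nonneg
  have e : (m : ℝ) + (μ + 1) + 1 = ((m : ℝ) + μ + 1) + 1 := by ring
  have hp : (m : ℝ) + μ + 1 ≠ 0 := by linarith
  have hG : Real.Gamma ((m : ℝ) + μ + 1) ≠ 0 := (Real.Gamma_pos_of_pos (by linarith)).ne'
  rw [e, Real.Gamma_add_one hp]
  field_simp
  ring

lemma besselJ_eq_besselEntire (μ : ℝ) {z : ℝ} (hz : 0 < z) :
    besselJ μ z = (z / 2) ^ μ * besselEntire μ (z ^ 2 / 4) := by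
  rw [besselJ, besselEntire, ← tsum_mul_left]
  refine tsum_congr fun m => ?_
  have h2 : 0 < z / 2 := by positivity
  rw [Real.rpow_add h2, Real.rpow_mul h2.le, Real.rpow_two, Real.rpow_natCast]
  have : (z / 2) ^ 2 = z ^ 2 / 4 := by ring
  rw [this]
  ring

/-- The function `z ↦ √z J_μ(z)`, a solution of `f'' = ((μ² - 1/4) / z² - 1) f`. -/
noncomputable def sqrtBesselJ (μ z : ℝ) : ℝ := Real.sqrt z * besselJ μ z

lemma sqrtBesselJ_eq (μ : ℝ) {z : ℝ} (hz : 0 < z) :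
    sqrtBesselJ μ z = 2 ^ (-μ) * (z ^ (μ + 1 / 2) * besselEntire μ (z ^ 2 / 4)) := by
  rw [sqrtBesselJ, besselJ_eq_besselEntire μ hz, Real.sqrt_eq_rpow, Real.rpow_add hz,
    Real.div_rpow hz.le (by norm_num), Real.rpow_neg (by norm_num)]
  ring

lemma hasDerivAt_sqrtBesselJ_aux {μ : ℝ} (hμ : -1 < μ) {z : ℝ} (hz : 0 < z) :
    HasDerivAt (sqrtBesselJ μ)
      ((μ + 1 / 2) / z * sqrtBesselJ μ z -
        2 ^ (-μ) * (z ^ (μ + 1 / 2) * (besselEntire (μ + 1) (z ^ 2 / 4) * (z / 2)))) z := by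
  have h1 : HasDerivAt (fun z : ℝ => z ^ 2 / 4) (z / 2) z :=
    ((hasDerivAt_pow 2 z).div_const 4).congr_deriv (by norm_num; ring)
  have h2 := HasDerivAt.comp z (hasDerivAt_besselEntire hμ (z ^ 2 / 4)) h1
  have h3 := ((Real.hasDerivAt_rpow_const (p := μ + 1 / 2) (Or.inl hz.ne')).mul h2).const_mul
    ((2 : ℝ) ^ (-μ))
  refine (h3.congr_of_eventuallyEq ?_).congr_deriv ?_
  · filter_upwards [lt_mem_nhds hz] with w hw
    rw [sqrtBesselJ_eq μ hw]
    rfl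
  · rw [sqrtBesselJ_eq μ hz, Real.rpow_sub_one hz.ne']
    simp only [Function.comp]
    field_simp
    ring

lemma hasDerivAt_sqrtBesselJ {μ : ℝ} (hμ : -1 < μ) {z : ℝ} (hz : 0 < z) :
    HasDerivAt (sqrtBesselJ μ)
      ((μ + 1 / 2) / z * sqrtBesselJ μ z - sqrtBesselJ (μ + 1) z) z := by
  refine (hasDerivAt_sqrtBesselJ_aux hμ hz).congr_deriv ?_
  rw [sqrtBesselJ_eq (μ + 1) hz]
  have e1 : μ + 1 + 1 / 2 = (μ + 1 / 2) + 1 := by ring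
  have e2 : -(μ + 1) = -μ - 1 := by ring
  rw [e1, e2, Real.rpow_add_one hz.ne', Real.rpow_sub_one (by norm_num)]
  ring

lemma hasDerivAt_sqrtBesselJ_succ {μ : ℝ} (hμ : -1 < μ) {z : ℝ} (hz : 0 < z) :
    HasDerivAt (sqrtBesselJ (μ + 1))
      (sqrtBesselJ μ z - (μ + 1 / 2) / z * sqrtBesselJ (μ + 1) z) z := by
  refine (hasDerivAt_sqrtBesselJ_aux (μ := μ + 1) (by linarith) hz).congr_deriv ?_
  rw [sqrtBesselJ_eq (μ + 1) hz, sqrtBesselJ_eq μ hz, besselEntire_recurrence hμ]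
  have e1 : μ + 1 + 1 / 2 = (μ + 1 / 2) + 1 := by ring
  have e2 : -(μ + 1) = -μ - 1 := by ring
  have e3 : μ + 1 + 1 = μ + 2 := by ring
  rw [e1, e2, e3, Real.rpow_add_one hz.ne', Real.rpow_sub_one (by norm_num)]
  field_simp
  ring

lemma exists_abs_sqrtBesselJ_le {μ : ℝ} (hμ : -1 < μ) :
    ∃ C : ℝ, 0 < C ∧ ∀ z : ℝ, 0 < z → z ≤ 1 → |sqrtBesselJ μ z| ≤ C * z ^ (μ + 1 / 2) := by
  have hc : Continuous (besselEntire μ) :=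
    continuous_iff_continuousAt.2 fun s => (hasDerivAt_besselEntire hμ s).continuousAt
  obtain ⟨B, hB⟩ := (isCompact_Icc (a := (0 : ℝ)) (b := 1)).exists_bound_of_continuousOn
    hc.continuousOn
  have hB0 : 0 ≤ B := (norm_nonneg _).trans (hB 0 (by simp))
  refine ⟨2 ^ (-μ) * (B + 1), by positivity, fun z hz hz1 => ?_⟩
  have h1 : |besselEntire μ (z ^ 2 / 4)| ≤ B + 1 :=
    (hB _ ⟨by positivity, by nlinarith⟩).trans (by linarith)
  have h2 : 0 < z ^ (μ + 1 / 2) := by positivity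
  rw [sqrtBesselJ_eq μ hz, abs_mul, abs_mul, abs_of_pos h2,
    abs_of_pos (by positivity : (0 : ℝ) < 2 ^ (-μ))]
  calc _ ≤ (2 : ℝ) ^ (-μ) * (z ^ (μ + 1 / 2) * (B + 1)) := by gcongr
    _ = _ := by ring

/-- `f` solves the normal form `f'' = (c / z² - 1) f` of Bessel's equation on `(0, ∞)`,
where `f'` is the derivative of the function `f`. -/
def IsBesselSolution (c : ℝ) (f f' : ℝ → ℝ) : Prop :=
  ∀ z : ℝ, 0 < z → HasDerivAt f (f' z) z ∧ HasDerivAt f' ((c / z ^ 2 - 1) * f z) z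

lemma norm_sub_le_of_norm_deriv_le {E : Type*} [NormedAddCommGroup E] [NormedSpace ℝ E]
    {α α' : ℝ → E} {M M' : ℝ → ℝ} {a b : ℝ} (hab : a ≤ b)
    (hα : ∀ z ∈ Icc a b, HasDerivAt α (α' z) z) (hM : ∀ z ∈ Icc a b, HasDerivAt M (M' z) z)
    (h : ∀ z ∈ Icc a b, ‖α' z‖ ≤ M' z) : ‖α b - α a‖ ≤ M b - M a := by
  have := image_norm_le_of_norm_deriv_right_le_deriv_boundary' (a := a) (b := b)
    (f := fun z => α z - α a) (f' := α') (B := fun z => M z - M a) (B' := M')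
    (fun z hz => ((hα z hz).sub_const _).continuousAt.continuousWithinAt)
    (fun z hz => ((hα z (Ico_subset_Icc_self hz)).sub_const _).hasDerivWithinAt) (by simp)
    (fun z hz => ((hM z hz).sub_const _).continuousAt.continuousWithinAt)
    (fun z hz => ((hM z (Ico_subset_Icc_self hz)).sub_const _).hasDerivWithinAt)
    (fun z hz => h z (Ico_subset_Icc_self hz))
  exact this ⟨hab, le_rfl⟩

lemma hasDerivAt_neg_const_div (C : ℝ) {z : ℝ} (hz : z ≠ 0) :
    HasDerivAt (fun z : ℝ => -(C / z)) (C / z ^ 2) z := by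
  have := ((hasDerivAt_inv hz).const_mul C).neg
  refine (this.congr_deriv ?_)
  field_simp

namespace IsBesselSolution

variable {c : ℝ} {f f' : ℝ → ℝ}

lemma hasDerivAt_energy (h : IsBesselSolution c f f') {z : ℝ} (hz : 0 < z) :
    HasDerivAt (fun z => f z ^ 2 + f' z ^ 2) (2 * c * (f z * f' z) / z ^ 2) z := by
  refine (((h z hz).1.pow 2).add ((h z hz).2.pow 2)).congr_deriv ?_
  simp
  ring

lemma abs_energy_deriv_le (z : ℝ) :
    |2 * c * (f z * f' z) / z ^ 2| ≤ |c| / z ^ 2 * (f z ^ 2 + f' z ^ 2) := by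
  have h2 : |2 * (f z * f' z)| ≤ f z ^ 2 + f' z ^ 2 := by
    rw [abs_le]; constructor <;> nlinarith [sq_nonneg (f z + f' z), sq_nonneg (f z - f' z)]
  have e : 2 * c * (f z * f' z) / z ^ 2 = c / z ^ 2 * (2 * (f z * f' z)) := by ring
  rw [e, abs_mul, abs_div, abs_of_nonneg (sq_nonneg z)]
  gcongr

lemma energy_mul_exp_antitoneOn (h : IsBesselSolution c f f') :
    AntitoneOn (fun z => (f z ^ 2 + f' z ^ 2) * Real.exp (-(-|c| / z))) (Ioi 0) := by
  have hd : ∀ z ∈ Ioi (0 : ℝ), HasDerivAt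
      (fun z => (f z ^ 2 + f' z ^ 2) * Real.exp (-(-|c| / z))) _ z := fun z hz =>
    (h.hasDerivAt_energy hz).mul (hasDerivAt_neg_const_div (-|c|) (ne_of_gt hz)).exp
  refine antitoneOn_of_deriv_nonpos (convex_Ioi 0)
    (fun z hz => (hd z hz).continuousAt.continuousWithinAt)
    (fun z hz => (hd z (interior_subset hz)).differentiableAt.differentiableWithinAt)
    fun z hz => ?_
  rw [(hd z (interior_subset hz)).deriv]
  have := (abs_le.1 (abs_energy_deriv_le (c := c) (f := f) (f' := f') z)).2
  have e : |c| / z ^ 2 * (f z ^ 2 + f' z ^ 2) =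
    -((f z ^ 2 + f' z ^ 2) * (-|c| / z ^ 2)) := by ring
  nlinarith [Real.exp_pos (-(-|c| / z))]

lemma energy_mul_exp_monotoneOn (h : IsBesselSolution c f f') :
    MonotoneOn (fun z => (f z ^ 2 + f' z ^ 2) * Real.exp (-(|c| / z))) (Ioi 0) := by
  have hd : ∀ z ∈ Ioi (0 : ℝ), HasDerivAt
      (fun z => (f z ^ 2 + f' z ^ 2) * Real.exp (-(|c| / z))) _ z := fun z hz =>
    (h.hasDerivAt_energy hz).mul (hasDerivAt_neg_const_div (|c|) (ne_of_gt hz)).exp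
  refine monotoneOn_of_deriv_nonneg (convex_Ioi 0)
    (fun z hz => (hd z hz).continuousAt.continuousWithinAt)
    (fun z hz => (hd z (interior_subset hz)).differentiableAt.differentiableWithinAt)
    fun z hz => ?_
  rw [(hd z (interior_subset hz)).deriv]
  have := (abs_le.1 (abs_energy_deriv_le (c := c) (f := f) (f' := f') z)).1
  nlinarith [Real.exp_pos (-(|c| / z))]

lemma exists_bound_energy (h : IsBesselSolution c f f') {z₀ : ℝ} (hz₀ : 0 < z₀) :
    ∃ B : ℝ, 0 < B ∧ ∀ z, z₀ ≤ z → |f z| ≤ B ∧ |f' z| ≤ B := by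
  set D := (f z₀ ^ 2 + f' z₀ ^ 2) * Real.exp (-(-|c| / z₀)) with hD
  have hD0 : 0 ≤ D := by positivity
  refine ⟨D + 1, by linarith, fun z hz => ?_⟩
  have h1 := h.energy_mul_exp_antitoneOn (mem_Ioi.2 hz₀) (mem_Ioi.2 (hz₀.trans_le hz)) hz
  have h2 : 1 ≤ Real.exp (-(-|c| / z)) :=
    Real.one_le_exp (by rw [neg_div, neg_neg]; have := hz₀.trans_le hz; positivity)
  have h3 : f z ^ 2 + f' z ^ 2 ≤ D := by
    refine le_trans ?_ h1
    exact le_mul_of_one_le_right (by positivity) h2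
  constructor <;> apply abs_le_of_sq_le_sq _ (by linarith) <;>
    nlinarith [sq_nonneg (f z), sq_nonneg (f' z)]

lemma exists_lower_bound_energy (h : IsBesselSolution c f f') {z₀ z₁ : ℝ} (hz₀ : 0 < z₀)
    (hz₁ : 0 < z₁) (hf : f z₁ ≠ 0) :
    ∃ m : ℝ, 0 < m ∧ ∀ z, z₀ ≤ z → m ^ 2 ≤ f z ^ 2 + f' z ^ 2 := by
  have hpos : 0 < f z₀ ^ 2 + f' z₀ ^ 2 := by
    have h1 : 0 < f z₁ ^ 2 + f' z₁ ^ 2 := by positivity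
    rcases le_total z₀ z₁ with hle | hle
    · have := h.energy_mul_exp_antitoneOn (mem_Ioi.2 hz₀) (mem_Ioi.2 hz₁) hle
      exact (mul_pos_iff_of_pos_right (Real.exp_pos _)).1
        ((mul_pos h1 (Real.exp_pos _)).trans_le this)
    · have := h.energy_mul_exp_monotoneOn (mem_Ioi.2 hz₁) (mem_Ioi.2 hz₀) hle
      exact (mul_pos_iff_of_pos_right (Real.exp_pos _)).1
        ((mul_pos h1 (Real.exp_pos _)).trans_le this)
  refine ⟨Real.sqrt ((f z₀ ^ 2 + f' z₀ ^ 2) * Real.exp (-(|c| / z₀))),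
    Real.sqrt_pos.2 (by positivity), fun z hz => ?_⟩
  rw [Real.sq_sqrt (by positivity)]
  refine (h.energy_mul_exp_monotoneOn (mem_Ioi.2 hz₀) (mem_Ioi.2 (hz₀.trans_le hz)) hz).trans ?_
  refine mul_le_of_le_one_right (by positivity) (Real.exp_le_one_iff.2 ?_)
  have := hz₀.trans_le hz
  rw [neg_nonpos]; positivity

/-- The complex amplitude of a solution: `f z = Re (amplitude z * exp (i z))`. -/
noncomputable def amplitude (χ f f' : ℝ → ℝ) (z : ℝ) : ℂ :=
  Complex.exp ((-z : ℝ) * Complex.I) * (f z - Complex.I * (χ z * f' z : ℝ))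

lemma amplitude_mul_exp (χ f f' : ℝ → ℝ) (z : ℝ) :
    amplitude χ f f' z * Complex.exp (z * Complex.I) =
      f z - Complex.I * (χ z * f' z : ℝ) := by
  rw [amplitude, mul_right_comm, ← Complex.exp_add]
  simp

lemma re_amplitude_mul_exp (χ f f' : ℝ → ℝ) (z : ℝ) :
    (amplitude χ f f' z * Complex.exp (z * Complex.I)).re = f z := by
  rw [amplitude_mul_exp]
  simp

lemma hasDerivAt_amplitude (h : IsBesselSolution c f f') {χ : ℝ → ℝ} {χ' z : ℝ} (hz : 0 < z)
    (hχ : HasDerivAt χ χ' z) :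
    HasDerivAt (amplitude χ f f') (Complex.exp ((-z : ℝ) * Complex.I) *
      (((1 - χ z) * f' z : ℝ) -
        Complex.I * (χ' * f' z + ((1 - χ z) + χ z * c / z ^ 2) * f z : ℝ))) z := by
  have h1 : HasDerivAt (fun z : ℝ => Complex.exp ((-z : ℝ) * Complex.I))
      (Complex.exp ((-z : ℝ) * Complex.I) * (((-1 : ℝ) : ℂ) * Complex.I)) z :=
    (((hasDerivAt_id z).neg.ofReal_comp).mul_const Complex.I).cexp
  have h2 := (hχ.mul (h z hz).2).ofReal_comp.const_mul Complex.I
  refine (h1.mul ((h z hz).1.ofReal_comp.sub h2)).congr_deriv ?_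
  simp only [Pi.mul_apply, Pi.sub_apply]
  push_cast
  linear_combination ((Complex.exp (-z * Complex.I)) * (χ z * f' z)) * Complex.I_sq

lemma norm_exp_mul_sub_le (z a b : ℝ) :
    ‖Complex.exp ((-z : ℝ) * Complex.I) * ((a : ℂ) - Complex.I * (b : ℝ))‖ ≤ |a| + |b| := by
  rw [norm_mul, Complex.norm_exp_ofReal_mul_I, one_mul]
  refine (norm_sub_le _ _).trans ?_
  simp

lemma abs_sub_sin_le (h : IsBesselSolution c f f') {B a b : ℝ} (ha : 0 < a) (hab : a ≤ b)
    (hB : ∀ z, a ≤ z → |f z| ≤ B) (hfa : f a = 0) :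
    |f b - f' a * Real.sin (b - a)| ≤ |c| * B * (1 / a - 1 / b) := by
  have key := norm_sub_le_of_norm_deriv_le (M := fun z => -(|c| * B / z)) hab
    (fun z hz => h.hasDerivAt_amplitude (χ := fun _ => 1) (ha.trans_le hz.1)
      (hasDerivAt_const z (1 : ℝ)))
    (fun z hz => hasDerivAt_neg_const_div (|c| * B) (ha.trans_le hz.1).ne')
    (fun z hz => by
      refine (norm_exp_mul_sub_le _ _ _).trans ?_
      have := hB z hz.1
      rw [sub_self, zero_mul, abs_zero, zero_add, zero_add, zero_add, one_mul, abs_mul,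
        abs_div, abs_of_nonneg (sq_nonneg z), mul_div_right_comm]
      gcongr)
  have e : f b - f' a * Real.sin (b - a) =
      ((amplitude (fun _ => 1) f f' b - amplitude (fun _ => 1) f f' a) *
        Complex.exp (b * Complex.I)).re := by
    have e' : amplitude (fun _ => 1) f f' a * Complex.exp (b * Complex.I) =
        Complex.exp ((b - a : ℝ) * Complex.I) * -(Complex.I * f' a) := by
      rw [amplitude, hfa, mul_right_comm, ← Complex.exp_add, ← add_mul, ← Complex.ofReal_add,
        neg_add_eq_sub]
      simp
    rw [sub_mul, Complex.sub_re, re_amplitude_mul_exp, e', Complex.mul_re,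
      Complex.exp_ofReal_mul_I_re, Complex.exp_ofReal_mul_I_im]
    simp
    ring
  rw [e]
  refine (Complex.abs_re_le_norm _).trans ?_
  rw [norm_mul, Complex.norm_exp_ofReal_mul_I, mul_one]
  refine key.trans (le_of_eq ?_)
  ring

/-- The bounded increasing function `(z / (1 + z)) ^ p`, used to control variations. -/
noncomputable def _root_.varMajorant (p z : ℝ) : ℝ := (z / (1 + z)) ^ p

lemma _root_.hasDerivAt_varMajorant (p : ℝ) {z : ℝ} (hz : 0 < z) :
    HasDerivAt (varMajorant p) (p * ((z / (1 + z)) ^ (p - 1) / (1 + z) ^ 2)) z := by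
  have h1 : HasDerivAt (fun z : ℝ => z / (1 + z)) (1 / (1 + z) ^ 2) z := by
    refine ((hasDerivAt_id z).div ((hasDerivAt_id z).const_add 1)
      (by simp only [id]; positivity)).congr_deriv ?_
    simp
  refine (h1.rpow_const (p := p) (Or.inl (by positivity))).congr_deriv ?_
  ring

lemma _root_.varMajorant_mem_Icc {p z : ℝ} (hp : 0 ≤ p) (hz : 0 < z) :
    varMajorant p z ∈ Icc (0 : ℝ) 1 := by
  have h1 : z / (1 + z) ≤ 1 := by rw [div_le_one (by positivity)]; linarith
  exact ⟨by unfold varMajorant; positivity, Real.rpow_le_one (by positivity) h1 hp⟩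

/-- A solution with controlled behaviour at the origin is the real part of `α z * exp (i z)` with
`α` of bounded variation on `(0, ∞)`. -/
lemma exists_amplitude (h : IsBesselSolution c f f') {p C : ℝ} (hp : 0 < p) (hp1 : p ≤ 1)
    (hC : 0 < C) (hf : ∀ z, 0 < z → z ≤ 1 → |f z| ≤ C * z ^ (p - 1))
    (hf' : ∀ z, 0 < z → z ≤ 1 → |f' z| ≤ C * z ^ (p - 1)) :
    ∃ (α : ℝ → ℂ) (K : ℝ), 0 < K ∧
      (∀ z : ℝ, f z = (α z * Complex.exp (z * Complex.I)).re) ∧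
      (∀ z, 0 < z → ‖α z‖ ≤ K) ∧
      ∀ a b, 0 < a → a ≤ b → ‖α b - α a‖ ≤ K * (varMajorant p b - varMajorant p a) := by
  obtain ⟨B, hB, hBf⟩ := h.exists_bound_energy one_pos
  set D := B + C with hD
  have hone : ∀ z : ℝ, 0 < z → 1 ≤ (z / (1 + z)) ^ (p - 1) := fun z hz => by
    have h1 : z / (1 + z) ≤ 1 := by rw [div_le_one (by positivity)]; linarith
    exact Real.one_le_rpow_of_pos_of_le_one_of_nonpos (by positivity) h1 (by linarith)
  have hle : ∀ z : ℝ, 0 < z → z ^ (p - 1) ≤ (z / (1 + z)) ^ (p - 1) := fun z hz =>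
    Real.rpow_le_rpow_of_nonpos (by positivity) (div_le_self hz.le (by linarith)) (by linarith)
  have hglob : ∀ z, 0 < z → |f z| ≤ D * (z / (1 + z)) ^ (p - 1) ∧
      |f' z| ≤ D * (z / (1 + z)) ^ (p - 1) := by
    intro z hz
    have h1 := hone z hz
    have h2 := hle z hz
    rcases le_total z 1 with hz1 | hz1
    · have h3 : C * z ^ (p - 1) ≤ D * (z / (1 + z)) ^ (p - 1) := by
        gcongr; linarith
      exact ⟨(hf z hz hz1).trans h3, (hf' z hz hz1).trans h3⟩
    · have h3 : B ≤ D * (z / (1 + z)) ^ (p - 1) := by nlinarith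
      exact ⟨(hBf z hz1).1.trans h3, (hBf z hz1).2.trans h3⟩
  set χ : ℝ → ℝ := fun z => 1 - (1 + z ^ 2)⁻¹ with hχ
  have hχd : ∀ z : ℝ, HasDerivAt χ (2 * z / (1 + z ^ 2) ^ 2) z := fun z => by
    have h1 : HasDerivAt (fun z : ℝ => 1 + z ^ 2) (2 * z) z :=
      ((hasDerivAt_pow 2 z).const_add 1).congr_deriv (by norm_num)
    refine ((h1.inv (by positivity)).const_sub 1).congr_deriv ?_
    ring
  have hχz : ∀ z : ℝ, 0 < z → χ z * c / z ^ 2 = c * (1 + z ^ 2)⁻¹ := fun z hz => by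
    simp only [hχ]; field_simp; ring
  set K := 2 * (3 + |c|) * D / p with hK
  have hD0 : 0 < D := by positivity
  have hK0 : 0 < K := by positivity
  have hvar : ∀ a b, 0 < a → a ≤ b → ‖amplitude χ f f' b - amplitude χ f f' a‖ ≤
      K * varMajorant p b - K * varMajorant p a := by
    intro a b ha hab
    refine norm_sub_le_of_norm_deriv_le (M := fun z => K * varMajorant p z) hab
      (fun z hz => h.hasDerivAt_amplitude (ha.trans_le hz.1) (hχd z))
      (fun z hz => (hasDerivAt_varMajorant p (ha.trans_le hz.1)).const_mul K) fun z hz => ?_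
    have hz0 : 0 < z := ha.trans_le hz.1
    refine (norm_exp_mul_sub_le _ _ _).trans ?_
    rw [hχz z hz0]
    obtain ⟨g1, g2⟩ := hglob z hz0
    set Q := (z / (1 + z)) ^ (p - 1) with hQ
    have hQ0 : 0 < Q := by positivity
    set r := (1 + z ^ 2)⁻¹ with hr
    have hr0 : 0 < r := by positivity
    have e1 : 1 - χ z = r := by simp [hχ, hr]
    have e2 : |2 * z / (1 + z ^ 2) ^ 2| ≤ r := by
      have e : (1 + z ^ 2)⁻¹ * (1 + z ^ 2) ^ 2 = 1 + z ^ 2 := by field_simp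
      rw [abs_of_nonneg (by positivity), hr, div_le_iff₀ (by positivity), e]
      nlinarith [sq_nonneg (z - 1)]
    have e3 : r ≤ 2 * ((1 + z) ^ 2)⁻¹ := by
      rw [hr, ← div_eq_mul_inv, inv_eq_one_div, div_le_div_iff₀ (by positivity) (by positivity)]
      nlinarith [sq_nonneg (z - 1)]
    rw [e1]
    calc |r * f' z| + |2 * z / (1 + z ^ 2) ^ 2 * f' z + (r + c * r) * f z|
        ≤ r * (D * Q) + (r * (D * Q) + (r + |c| * r) * (D * Q)) := by
          refine add_le_add ?_ ((abs_add_le _ _).trans (add_le_add ?_ ?_))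
          · rw [abs_mul, abs_of_pos hr0]; gcongr
          · rw [abs_mul]; gcongr
          · rw [abs_mul]
            gcongr
            refine (abs_add_le _ _).trans ?_
            rw [abs_mul, abs_of_pos hr0]
      _ = (3 + |c|) * D * Q * r := by ring
      _ ≤ (3 + |c|) * D * Q * (2 * ((1 + z) ^ 2)⁻¹) := by gcongr
      _ = K * (p * (Q / (1 + z) ^ 2)) := by rw [hK]; field_simp
  refine ⟨amplitude χ f f', ‖amplitude χ f f' 1‖ + K, by positivity,
    fun z => (re_amplitude_mul_exp χ f f' z).symm, fun z hz => ?_, fun a b ha hab => ?_⟩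
  · have m1 := varMajorant_mem_Icc hp.le one_pos
    have mz := varMajorant_mem_Icc hp.le hz
    have : ‖amplitude χ f f' z - amplitude χ f f' 1‖ ≤ K := by
      rcases le_total z 1 with hz1 | hz1
      · rw [norm_sub_rev]
        refine (hvar z 1 hz hz1).trans ?_
        nlinarith [m1.1, m1.2, mz.1, mz.2]
      · refine (hvar 1 z one_pos hz1).trans ?_
        nlinarith [m1.1, m1.2, mz.1, mz.2]
    calc ‖amplitude χ f f' z‖ = ‖amplitude χ f f' 1 +
          (amplitude χ f f' z - amplitude χ f f' 1)‖ := by congr 1; ring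
      _ ≤ _ := (norm_add_le _ _).trans (by gcongr)
  · have h1 := hvar a b ha hab
    have h2 : 0 ≤ varMajorant p b - varMajorant p a := by
      have := (norm_nonneg _).trans h1
      rw [← mul_sub] at this
      exact nonneg_of_mul_nonneg_right this hK0
    have := norm_nonneg (amplitude χ f f' 1)
    nlinarith

/-- `Λ` enumerates the positive zeros of `f` in increasing order. -/
structure _root_.EnumeratesZeros (f : ℝ → ℝ) (Λ : ℕ → ℝ) : Prop where
  strictMono : StrictMono Λ
  pos : ∀ n, 0 < Λ n
  eq_zero : ∀ n, f (Λ n) = 0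
  exists_eq : ∀ z, 0 < z → f z = 0 → ∃ n, Λ n = z

lemma _root_.EnumeratesZeros.zero_le {f : ℝ → ℝ} {Λ : ℕ → ℝ} (hΛ : EnumeratesZeros f Λ) (n : ℕ) :
    Λ 0 ≤ Λ n := hΛ.strictMono.monotone n.zero_le

lemma _root_.EnumeratesZeros.le_of_eq_zero {f : ℝ → ℝ} {Λ : ℕ → ℝ} (hΛ : EnumeratesZeros f Λ)
    {n : ℕ} {z : ℝ} (hz : Λ n < z) (hfz : f z = 0) : Λ (n + 1) ≤ z := by
  obtain ⟨k, rfl⟩ := hΛ.exists_eq z ((hΛ.pos n).trans hz) hfz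
  exact hΛ.strictMono.monotone (Nat.succ_le_of_lt (hΛ.strictMono.lt_iff_lt.1 hz))

lemma _root_.EnumeratesZeros.sum_inv_sub_inv_le {f : ℝ → ℝ} {Λ : ℕ → ℝ}
    (hΛ : EnumeratesZeros f Λ) (N : ℕ) :
    ∑ n ∈ Finset.range N, (1 / Λ n - 1 / Λ (n + 1)) ≤ 1 / Λ 0 := by
  rw [Finset.sum_range_sub' (fun n => 1 / Λ n)]
  have := hΛ.pos N
  have : 0 < 1 / Λ N := by positivity
  linarith

lemma _root_.EnumeratesZeros.inv_sub_inv_nonneg {f : ℝ → ℝ} {Λ : ℕ → ℝ}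
    (hΛ : EnumeratesZeros f Λ) (n : ℕ) : 0 ≤ 1 / Λ n - 1 / Λ (n + 1) :=
  sub_nonneg.2 (one_div_le_one_div_of_le (hΛ.pos n) (hΛ.strictMono n.lt_succ_self).le)

variable {Λ : ℕ → ℝ}

lemma exists_lower_bound_deriv_zeros (h : IsBesselSolution c f f') (hΛ : EnumeratesZeros f Λ) :
    ∃ m : ℝ, 0 < m ∧ ∀ n, m ≤ |f' (Λ n)| := by
  have hne : f (Λ 0 / 2) ≠ 0 := fun h0 => by
    obtain ⟨n, hn⟩ := hΛ.exists_eq _ (half_pos (hΛ.pos 0)) h0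
    have := hΛ.zero_le n
    linarith [hΛ.pos 0]
  obtain ⟨m, hm, hmE⟩ := h.exists_lower_bound_energy (hΛ.pos 0) (half_pos (hΛ.pos 0)) hne
  refine ⟨m, hm, fun n => ?_⟩
  have := hmE (Λ n) (hΛ.zero_le n)
  rw [hΛ.eq_zero n] at this
  rw [← abs_of_pos hm]
  exact sq_le_sq.1 (by linarith)

lemma exists_gap_le (h : IsBesselSolution c f f') (hΛ : EnumeratesZeros f Λ) :
    ∃ g : ℝ, 0 < g ∧ ∀ n, g ≤ Λ (n + 1) - Λ n := by
  obtain ⟨m, hm, hmΛ⟩ := h.exists_lower_bound_deriv_zeros hΛ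
  obtain ⟨B, hB, hBf⟩ := h.exists_bound_energy (hΛ.pos 0)
  have h0 := hΛ.pos 0
  set L := (|c| / Λ 0 ^ 2 + 1) * B with hL
  have hL0 : 0 < L := by positivity
  refine ⟨m / L, by positivity, fun n => ?_⟩
  have hn := hΛ.strictMono n.lt_succ_self
  obtain ⟨s, hs, hfs⟩ := exists_hasDerivAt_eq_zero (f := f) (f' := f') hn
    (fun z hz => (h z ((hΛ.pos n).trans_le hz.1)).1.continuousAt.continuousWithinAt)
    (by rw [hΛ.eq_zero, hΛ.eq_zero]) (fun z hz => (h z ((hΛ.pos n).trans hz.1)).1)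
  have hlip := norm_sub_le_of_norm_deriv_le (M := fun z => L * z) (M' := fun _ => L) hs.1.le
    (fun z hz => (h z ((hΛ.pos n).trans_le hz.1)).2)
    (fun z _ => ((hasDerivAt_id z).const_mul L).congr_deriv (mul_one L)) (fun z hz => by
      have hz0 : Λ 0 ≤ z := (hΛ.zero_le n).trans hz.1
      rw [Real.norm_eq_abs, abs_mul]
      refine mul_le_mul ?_ (hBf z hz0).1 (abs_nonneg _) (by positivity)
      refine (abs_sub _ _).trans ?_
      rw [abs_div, abs_one, abs_of_nonneg (sq_nonneg z)]
      gcongr)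
  rw [hfs, zero_sub, norm_neg, Real.norm_eq_abs] at hlip
  rw [div_le_iff₀ hL0]
  have := hmΛ n
  nlinarith [hs.2]

lemma exists_linear_growth_zeros (h : IsBesselSolution c f f') (hΛ : EnumeratesZeros f Λ) :
    ∃ g : ℝ, 0 < g ∧ ∀ n : ℕ, g * (n + 1) ≤ Λ n := by
  obtain ⟨g, hg, hgap⟩ := h.exists_gap_le hΛ
  refine ⟨min g (Λ 0), lt_min hg (hΛ.pos 0), fun n => ?_⟩
  induction n with
  | zero => simp
  | succ n ih =>
    push_cast
    nlinarith [hgap n, min_le_left g (Λ 0)]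

lemma exists_sum_abs_inv_sq_deriv_le (h : IsBesselSolution c f f') (hΛ : EnumeratesZeros f Λ) :
    ∃ K : ℝ, 0 < K ∧ (∀ n, |(f' (Λ n) ^ 2)⁻¹| ≤ K) ∧
      ∀ N, ∑ n ∈ Finset.range N, |(f' (Λ (n + 1)) ^ 2)⁻¹ - (f' (Λ n) ^ 2)⁻¹| ≤ K := by
  obtain ⟨m, hm, hmΛ⟩ := h.exists_lower_bound_deriv_zeros hΛ
  obtain ⟨B, hB, hBf⟩ := h.exists_bound_energy (hΛ.pos 0)
  have h0 := hΛ.pos 0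
  have hmsq : ∀ n, m ^ 2 ≤ f' (Λ n) ^ 2 := fun n => by
    rw [← sq_abs (f' (Λ n))]; have := hmΛ n; gcongr
  have hstep : ∀ n, |(f' (Λ (n + 1)) ^ 2)⁻¹ - (f' (Λ n) ^ 2)⁻¹| ≤
      2 * |c| * B ^ 2 / m ^ 4 * (1 / Λ n - 1 / Λ (n + 1)) := by
    intro n
    have key := norm_sub_le_of_norm_deriv_le (M := fun z => -(2 * |c| * B ^ 2 / z))
      (hΛ.strictMono n.lt_succ_self).le
      (fun z hz => h.hasDerivAt_energy ((hΛ.pos n).trans_le hz.1))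
      (fun z hz => hasDerivAt_neg_const_div _ ((hΛ.pos n).trans_le hz.1).ne')
      (fun z hz => by
        obtain ⟨b1, b2⟩ := hBf z ((hΛ.zero_le n).trans hz.1)
        rw [Real.norm_eq_abs, abs_div, abs_mul, abs_mul, abs_mul, abs_of_nonneg (sq_nonneg z),
          abs_two, pow_two B]
        gcongr)
    simp only [Nat.succ_eq_add_one, hΛ.eq_zero, Real.norm_eq_abs] at key
    have p1 : 0 < f' (Λ n) ^ 2 := (by positivity : 0 < m ^ 2).trans_le (hmsq n)
    have p2 : 0 < f' (Λ (n + 1)) ^ 2 := (by positivity : 0 < m ^ 2).trans_le (hmsq (n + 1))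
    rw [inv_sub_inv p2.ne' p1.ne', abs_div, abs_of_pos (mul_pos p2 p1), div_le_iff₀ (by positivity),
      abs_sub_comm]
    have e4 : m ^ 4 ≤ f' (Λ (n + 1)) ^ 2 * f' (Λ n) ^ 2 := by
      calc m ^ 4 = m ^ 2 * m ^ 2 := by ring
        _ ≤ _ := mul_le_mul (hmsq _) (hmsq _) (by positivity) (by positivity)
    have hnn := hΛ.inv_sub_inv_nonneg n
    calc _ ≤ 2 * |c| * B ^ 2 * (1 / Λ n - 1 / Λ (n + 1)) := by
          refine le_trans (le_of_eq ?_) (key.trans (le_of_eq ?_))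
          · congr 1; ring
          · ring
      _ = 2 * |c| * B ^ 2 / m ^ 4 * (1 / Λ n - 1 / Λ (n + 1)) * m ^ 4 := by field_simp
      _ ≤ _ := by gcongr
  refine ⟨(m ^ 2)⁻¹ + 2 * |c| * B ^ 2 / m ^ 4 * (1 / Λ 0), by positivity, fun n => ?_, fun N => ?_⟩
  · rw [abs_of_nonneg (by positivity)]
    refine (inv_anti₀ (by positivity) (hmsq n)).trans ?_
    have : 0 ≤ 2 * |c| * B ^ 2 / m ^ 4 * (1 / Λ 0) := by positivity
    linarith
  · refine (Finset.sum_le_sum fun n _ => hstep n).trans ?_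
    rw [← Finset.mul_sum]
    have := hΛ.sum_inv_sub_inv_le N
    have h2 : 0 ≤ (m ^ 2)⁻¹ := by positivity
    have : 2 * |c| * B ^ 2 / m ^ 4 * ∑ n ∈ Finset.range N, (1 / Λ n - 1 / Λ (n + 1)) ≤
      2 * |c| * B ^ 2 / m ^ 4 * (1 / Λ 0) := by gcongr
    linarith

lemma abs_sub_pi_le_of_sin {s : ℝ} (h0 : Real.pi / 2 ≤ s) (h1 : s ≤ 3 * Real.pi / 2) :
    |s - Real.pi| ≤ Real.pi / 2 * |Real.sin s| := by
  have hpi := Real.pi_pos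
  have e : Real.sin s = -Real.sin (s - Real.pi) := by rw [Real.sin_sub_pi, neg_neg]
  have := Real.mul_abs_le_abs_sin (x := s - Real.pi) (abs_le.2 ⟨by linarith, by linarith⟩)
  rw [e, abs_neg]
  calc |s - Real.pi| = Real.pi / 2 * (2 / Real.pi * |s - Real.pi|) := by field_simp
    _ ≤ _ := by gcongr

lemma summable_gap_sub_pi (h : IsBesselSolution c f f') (hΛ : EnumeratesZeros f Λ) :
    Summable fun n => |Λ (n + 1) - Λ n - Real.pi| := by
  obtain ⟨m, hm, hmΛ⟩ := h.exists_lower_bound_deriv_zeros hΛ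
  obtain ⟨B, hB, hBf⟩ := h.exists_bound_energy (hΛ.pos 0)
  obtain ⟨g, hg, hgrow⟩ := h.exists_linear_growth_zeros hΛ
  have h0 := hΛ.pos 0
  have hpi := Real.pi_pos
  have hsum : Summable fun n => 1 / Λ n - 1 / Λ (n + 1) :=
    summable_of_sum_range_le hΛ.inv_sub_inv_nonneg hΛ.sum_inv_sub_inv_le
  refine Summable.of_norm_bounded_eventually_nat
    (hsum.mul_left (Real.pi / 2 * (|c| * B / m))) ?_
  have htend : Tendsto Λ atTop atTop := by
    refine tendsto_atTop_mono hgrow (Tendsto.const_mul_atTop hg ?_)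
    exact tendsto_atTop_add_const_right _ _ tendsto_natCast_atTop_atTop
  filter_upwards [htend.eventually_ge_atTop 1,
    htend.eventually_gt_atTop (2 * (|c| * B / m) + 1)] with n hn1 hn2
  set a := Λ n with ha
  set b := Λ (n + 1) with hb
  have hab : a < b := hΛ.strictMono n.lt_succ_self
  have ha0 : 0 < a := hΛ.pos n
  set q := |c| * B / m with hq
  have hq0 : 0 ≤ q := by positivity
  have hqm : |c| * B = q * m := by rw [hq]; field_simp
  have hma := hmΛ n
  have happ : ∀ z, a ≤ z → |f z - f' a * Real.sin (z - a)| ≤ q * m * (1 / a - 1 / z) :=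
    fun z hz => hqm ▸ h.abs_sub_sin_le ha0 hz
      (fun w hw => (hBf w ((hΛ.zero_le n).trans hw)).1) (hΛ.eq_zero n)
  have hsmall : ∀ z, a ≤ z → |f z - f' a * Real.sin (z - a)| < m := fun z hz => by
    refine (happ z hz).trans_lt ?_
    have hz0 : 0 < 1 / z := by have := ha0.trans_le hz; positivity
    have h2 : q * (1 / a) < 1 := by
      rw [mul_one_div, div_lt_one ha0]; linarith
    calc q * m * (1 / a - 1 / z) ≤ q * m * (1 / a) := by gcongr; linarith
      _ = m * (q * (1 / a)) := by ring
      _ < m * 1 := by gcongr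
      _ = m := mul_one m
  have hupper : b - a ≤ 3 * Real.pi / 2 := by
    have hcont : ContinuousOn f (Icc (a + Real.pi / 2) (a + 3 * Real.pi / 2)) := fun z hz =>
      (h z (by linarith [hz.1])).1.continuousAt.continuousWithinAt
    have s1 := hsmall (a + Real.pi / 2) (by linarith)
    have s2 := hsmall (a + 3 * Real.pi / 2) (by linarith)
    have e3 : Real.sin (3 * Real.pi / 2) = -1 := by
      rw [show 3 * Real.pi / 2 = Real.pi / 2 + Real.pi by ring, Real.sin_add_pi, Real.sin_pi_div_two]
    rw [add_sub_cancel_left, Real.sin_pi_div_two, abs_lt] at s1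
    rw [add_sub_cancel_left, e3, abs_lt] at s2
    have hle : a + Real.pi / 2 ≤ a + 3 * Real.pi / 2 := by linarith
    have : ∃ z ∈ Icc (a + Real.pi / 2) (a + 3 * Real.pi / 2), f z = 0 := by
      rcases abs_cases (f' a) with ⟨he, -⟩ | ⟨he, -⟩
      · exact intermediate_value_Icc' hle hcont ⟨by linarith, by linarith⟩
      · exact intermediate_value_Icc hle hcont ⟨by linarith, by linarith⟩
    obtain ⟨z, hz, hfz⟩ := this
    have : b ≤ z := hΛ.le_of_eq_zero (n := n) (by linarith [hz.1]) hfz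
    linarith [hz.2]
  have hsin : |Real.sin (b - a)| ≤ q * (1 / a - 1 / b) := by
    have := happ b hab.le
    rw [hb, hΛ.eq_zero, ← hb, zero_sub, abs_neg, abs_mul] at this
    have h2 : m * |Real.sin (b - a)| ≤ m * (q * (1 / a - 1 / b)) := by
      calc _ ≤ |f' a| * |Real.sin (b - a)| := by gcongr
        _ ≤ _ := this
        _ = _ := by ring
    exact le_of_mul_le_mul_left h2 hm
  have hlower : Real.pi / 2 ≤ b - a := by
    by_contra! hlt
    have h1 := Real.mul_le_sin (x := b - a) (by linarith) hlt.le
    have h2 : q * (1 / a - 1 / b) ≤ q / a * (b - a) := by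
      have hb0 : 0 < b := ha0.trans hab
      have hb1 : 1 ≤ b := by linarith
      have : 1 / a - 1 / b = (1 / a * (b - a)) / b := by field_simp
      rw [this, div_eq_mul_one_div q, mul_assoc]
      gcongr
      exact div_le_self (mul_nonneg (by positivity) (by linarith)) hb1
    have h3 : 2 / Real.pi * (b - a) ≤ q / a * (b - a) :=
      h1.trans ((le_abs_self _).trans (hsin.trans h2))
    have h4 : 2 / Real.pi ≤ q / a := le_of_mul_le_mul_right h3 (by linarith)
    rw [div_le_div_iff₀ hpi ha0] at h4
    have := Real.pi_lt_four
    nlinarith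
  rw [Real.norm_eq_abs, abs_abs]
  calc _ ≤ Real.pi / 2 * |Real.sin (b - a)| := abs_sub_pi_le_of_sin hlower hupper
    _ ≤ Real.pi / 2 * (q * (1 / a - 1 / b)) := by gcongr
    _ = _ := by ring

end IsBesselSolution

/-- The sequence `a` is bounded by `K` and so is its total variation. -/
structure HasVariationBound (K : ℝ) (a : ℕ → ℂ) : Prop where
  norm_le : ∀ n, ‖a n‖ ≤ K
  sum_le : ∀ N, ∑ n ∈ Finset.range N, ‖a (n + 1) - a n‖ ≤ K

namespace HasVariationBound

variable {K L : ℝ} {a b : ℕ → ℂ}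

lemma nonneg (ha : HasVariationBound K a) : 0 ≤ K := (norm_nonneg _).trans (ha.norm_le 0)

lemma mul (ha : HasVariationBound K a) (hb : HasVariationBound L b) :
    HasVariationBound (2 * K * L) fun n => a n * b n := by
  have hK := ha.nonneg
  have hL := hb.nonneg
  refine ⟨fun n => ?_, fun N => ?_⟩
  · rw [norm_mul]
    have := mul_le_mul (ha.norm_le n) (hb.norm_le n) (norm_nonneg _) hK
    nlinarith [mul_nonneg hK hL]
  · calc ∑ n ∈ Finset.range N, ‖a (n + 1) * b (n + 1) - a n * b n‖
        ≤ ∑ n ∈ Finset.range N, (K * ‖b (n + 1) - b n‖ + ‖a (n + 1) - a n‖ * L) := by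
          refine Finset.sum_le_sum fun n _ => ?_
          have e : a (n + 1) * b (n + 1) - a n * b n =
            a (n + 1) * (b (n + 1) - b n) + (a (n + 1) - a n) * b n := by ring
          rw [e]
          refine (norm_add_le _ _).trans ?_
          rw [norm_mul, norm_mul]
          gcongr
          · exact ha.norm_le _
          · exact hb.norm_le _
      _ ≤ K * L + K * L := by
          rw [Finset.sum_add_distrib, ← Finset.mul_sum, ← Finset.sum_mul]
          gcongr
          · exact hb.sum_le N
          · exact ha.sum_le N
      _ = 2 * K * L := by ring

lemma conj (ha : HasVariationBound K a) :
    HasVariationBound K fun n => (starRingEnd ℂ) (a n) := by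
  refine ⟨fun n => by rw [RCLike.norm_conj]; exact ha.norm_le n, fun N => ?_⟩
  simp_rw [← map_sub, RCLike.norm_conj]
  exact ha.sum_le N

lemma of_antitone {r : ℕ → ℝ} (hr : Antitone r) (h0 : ∀ n, 0 ≤ r n) (h1 : r 0 ≤ 1) :
    HasVariationBound 1 fun n => (r n : ℂ) := by
  refine ⟨fun n => ?_, fun N => ?_⟩
  · rw [Complex.norm_real, Real.norm_eq_abs, abs_of_nonneg (h0 n)]
    exact (hr n.zero_le).trans h1
  · have : ∀ n ∈ Finset.range N, ‖(r (n + 1) : ℂ) - r n‖ = r n - r (n + 1) := fun n _ => by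
      rw [← Complex.ofReal_sub, Complex.norm_real, Real.norm_eq_abs, abs_sub_comm,
        abs_of_nonneg (sub_nonneg.2 (hr n.le_succ))]
    rw [Finset.sum_congr rfl this, Finset.sum_range_sub']
    linarith [h0 N]

lemma norm_sum_mul_pow_le (ha : HasVariationBound K a) {q : ℂ} (hq : ‖q‖ = 1) (N : ℕ) :
    ‖∑ n ∈ Finset.range N, a n * q ^ n‖ * ‖q - 1‖ ≤ 3 * K := by
  have e : (∑ n ∈ Finset.range N, a n * q ^ n) * (q - 1) =
      a N * q ^ N - a 0 - ∑ n ∈ Finset.range N, (a (n + 1) - a n) * q ^ (n + 1) := by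
    induction N with
    | zero => simp
    | succ N ih =>
      rw [Finset.sum_range_succ, add_mul, ih, Finset.sum_range_succ]
      ring
  rw [← norm_mul, e]
  have h3 : ‖∑ n ∈ Finset.range N, (a (n + 1) - a n) * q ^ (n + 1)‖ ≤ K := by
    refine (norm_sum_le _ _).trans ?_
    simpa [norm_mul, norm_pow, hq] using ha.sum_le N
  have h1 : ‖a N * q ^ N‖ ≤ K := by simpa [norm_mul, norm_pow, hq] using ha.norm_le N
  have h2 := ha.norm_le 0
  refine (norm_sub_le _ _).trans ?_
  have := norm_sub_le (a N * q ^ N) (a 0)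
  linarith

/-- A phase `exp (i w Λ n)` with `Λ n - π n` of bounded variation behaves like a geometric
sequence. -/
lemma norm_sum_mul_exp_le (ha : HasVariationBound K a) {Λ : ℕ → ℝ}
    (hΛ : Summable fun n => |Λ (n + 1) - Λ n - Real.pi|) {w : ℝ} (hw : |w| ≤ 2) (N : ℕ) :
    ‖∑ n ∈ Finset.range N, a n * Complex.exp ((Λ n * w : ℝ) * Complex.I)‖ *
      (2 * |Real.sin (Real.pi * w / 2)|) ≤
      6 * K * (1 + 2 * ∑' n, |Λ (n + 1) - Λ n - Real.pi|) := by
  set S := ∑' n, |Λ (n + 1) - Λ n - Real.pi| with hS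
  have hS0 : 0 ≤ S := tsum_nonneg fun _ => abs_nonneg _
  have hγ : HasVariationBound (1 + 2 * S) fun n : ℕ =>
      Complex.exp (((Λ n - Real.pi * n) * w : ℝ) * Complex.I) := by
    refine ⟨fun n => by rw [Complex.norm_exp_ofReal_mul_I]; linarith, fun N => ?_⟩
    calc _ ≤ ∑ n ∈ Finset.range N, 2 * |Λ (n + 1) - Λ n - Real.pi| := by
          refine Finset.sum_le_sum fun n _ => ?_
          set s := (Λ n - Real.pi * n) * w with hs
          have e : ((Λ (n + 1) - Real.pi * (n + 1 : ℕ)) * w : ℝ) =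
            s + (Λ (n + 1) - Λ n - Real.pi) * w := by push_cast; rw [hs]; ring
          rw [e, Complex.ofReal_add, add_mul, Complex.exp_add, ← mul_sub_one, norm_mul,
            Complex.norm_exp_ofReal_mul_I, one_mul, mul_comm _ Complex.I]
          refine (Real.norm_exp_I_mul_ofReal_sub_one_le).trans ?_
          rw [Real.norm_eq_abs, abs_mul, mul_comm]
          gcongr
      _ ≤ 2 * S := by
          rw [← Finset.mul_sum]
          gcongr
          exact hΛ.sum_le_tsum _ fun _ _ => abs_nonneg _
      _ ≤ _ := by linarith
  have key := (ha.mul hγ).norm_sum_mul_pow_le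
    (Complex.norm_exp_ofReal_mul_I (Real.pi * w)) N
  have e1 : ‖Complex.exp ((Real.pi * w : ℝ) * Complex.I) - 1‖ =
      2 * |Real.sin (Real.pi * w / 2)| := by
    rw [mul_comm, Complex.norm_exp_I_mul_ofReal_sub_one, Real.norm_eq_abs, abs_mul, abs_two]
  rw [e1] at key
  refine le_trans (le_of_eq ?_) (key.trans (le_of_eq (by ring)))
  congr 2
  refine Finset.sum_congr rfl fun n _ => ?_
  rw [mul_assoc, ← Complex.exp_nat_mul, ← Complex.exp_add]
  congr 2
  push_cast
  ring

lemma comp_dilation {α : ℝ → ℂ} {p : ℝ} (hp : 0 ≤ p) (hK : ∀ z, 0 < z → ‖α z‖ ≤ K)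
    (hα : ∀ a b, 0 < a → a ≤ b → ‖α b - α a‖ ≤ K * (varMajorant p b - varMajorant p a))
    {Λ : ℕ → ℝ} (hΛ : Monotone Λ) (hpos : ∀ n, 0 < Λ n) {x : ℝ} (hx : 0 < x) :
    HasVariationBound K fun n => α (Λ n * x) := by
  have h0 : 0 ≤ K := (norm_nonneg _).trans (hK 1 one_pos)
  refine ⟨fun n => hK _ (mul_pos (hpos n) hx), fun N => ?_⟩
  calc _ ≤ ∑ n ∈ Finset.range N,
        K * (varMajorant p (Λ (n + 1) * x) - varMajorant p (Λ n * x)) :=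
        Finset.sum_le_sum fun n _ => hα _ _ (mul_pos (hpos n) hx)
          (mul_le_mul_of_nonneg_right (hΛ n.le_succ) hx.le)
    _ = K * (varMajorant p (Λ N * x) - varMajorant p (Λ 0 * x)) := by
        rw [← Finset.mul_sum, Finset.sum_range_sub (fun n => varMajorant p (Λ n * x))]
    _ ≤ K * 1 := by
        gcongr
        have m1 := varMajorant_mem_Icc hp (mul_pos (hpos N) hx)
        have m2 := varMajorant_mem_Icc hp (mul_pos (hpos 0) hx)
        linarith [m1.2, m2.1]
    _ = K := mul_one K

end HasVariationBound

lemma abs_le_abs_sin_half_pi_mul {w δ : ℝ} (hw0 : 0 ≤ w) (h1 : δ ≤ w) (h2 : δ ≤ 2 - w)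
    (hw2 : w ≤ 2) : δ ≤ |Real.sin (Real.pi * w / 2)| := by
  have hpi := Real.pi_pos
  refine le_trans ?_ (le_abs_self _)
  rcases le_total w 1 with hw | hw
  · have := Real.mul_le_sin (x := Real.pi * w / 2) (by positivity) (by nlinarith)
    have e : 2 / Real.pi * (Real.pi * w / 2) = w := by field_simp
    linarith
  · have := Real.mul_le_sin (x := Real.pi * (2 - w) / 2) (by nlinarith) (by nlinarith)
    have e : 2 / Real.pi * (Real.pi * (2 - w) / 2) = 2 - w := by field_simp
    have e2 : Real.pi * (2 - w) / 2 = Real.pi - Real.pi * w / 2 := by ring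
    rw [e, e2, Real.sin_pi_sub] at this
    linarith

lemma re_mul_re_eq (z w : ℂ) :
    z.re * w.re = ((z * w).re + (z * (starRingEnd ℂ) w).re) / 2 := by
  simp [Complex.mul_re]

lemma tsum_exp_neg_le {s : ℝ} (hs : 0 < s) :
    Summable (fun n : ℕ => Real.exp (-s * (n + 1))) ∧
      ∑' n : ℕ, Real.exp (-s * (n + 1)) ≤ 2 / s ^ 2 := by
  have e : ∀ n : ℕ, Real.exp (-s * (n + 1)) = Real.exp (-s) * Real.exp (-s) ^ n := fun n => by
    rw [← Real.exp_nat_mul, ← Real.exp_add]; congr 1; ring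
  have hr : Real.exp (-s) < 1 := Real.exp_lt_one_iff.2 (by linarith)
  have hsum := (hasSum_geometric_of_lt_one (Real.exp_pos _).le hr).mul_left (Real.exp (-s))
  simp_rw [e]
  refine ⟨hsum.summable, ?_⟩
  have hq := Real.quadratic_le_exp_of_nonneg hs.le
  rw [hsum.tsum_eq, ← div_eq_mul_inv, div_le_div_iff₀ (by linarith) (by positivity)]
  have h1 : Real.exp (-s) * Real.exp s = 1 := by rw [← Real.exp_add]; simp
  have h2 := mul_le_mul_of_nonneg_left hq (Real.exp_pos (-s)).le
  nlinarith [Real.exp_pos (-s)]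

lemma isBesselSolution_sqrtBesselJ {ν : ℝ} (hν : -1 < ν) :
    IsBesselSolution ((ν + 1 / 2) ^ 2 - (ν + 1 / 2)) (sqrtBesselJ ν)
      (fun z => (ν + 1 / 2) / z * sqrtBesselJ ν z - sqrtBesselJ (ν + 1) z) := by
  intro z hz
  refine ⟨hasDerivAt_sqrtBesselJ hν hz, ?_⟩
  have h1 := ((hasDerivAt_inv hz.ne').const_mul (ν + 1 / 2)).mul (hasDerivAt_sqrtBesselJ hν hz)
  refine (h1.sub (hasDerivAt_sqrtBesselJ_succ hν hz)).congr_deriv ?_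
  field_simp
  ring

lemma isBesselSolution_sqrtBesselJ_succ {ν : ℝ} (hν : -1 < ν) :
    IsBesselSolution ((ν + 1 / 2) ^ 2 + (ν + 1 / 2)) (sqrtBesselJ (ν + 1))
      (fun z => sqrtBesselJ ν z - (ν + 1 / 2) / z * sqrtBesselJ (ν + 1) z) := by
  intro z hz
  refine ⟨hasDerivAt_sqrtBesselJ_succ hν hz, ?_⟩
  have h1 := ((hasDerivAt_inv hz.ne').const_mul (ν + 1 / 2)).mul
    (hasDerivAt_sqrtBesselJ_succ hν hz)
  refine ((hasDerivAt_sqrtBesselJ hν hz).sub h1).congr_deriv ?_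
  field_simp
  ring

lemma exists_amplitude_sqrtBesselJ {ν : ℝ} (hν : -(1 / 2) < ν) :
    ∃ (p : ℝ) (α β : ℝ → ℂ) (K : ℝ), 0 < p ∧ 0 < K ∧
      (∀ z : ℝ, sqrtBesselJ ν z = (α z * Complex.exp (z * Complex.I)).re) ∧
      (∀ z : ℝ, sqrtBesselJ (ν + 1) z = (β z * Complex.exp (z * Complex.I)).re) ∧
      (∀ z, 0 < z → ‖α z‖ ≤ K) ∧ (∀ z, 0 < z → ‖β z‖ ≤ K) ∧
      (∀ a b, 0 < a → a ≤ b → ‖α b - α a‖ ≤ K * (varMajorant p b - varMajorant p a)) ∧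
      ∀ a b, 0 < a → a ≤ b → ‖β b - β a‖ ≤ K * (varMajorant p b - varMajorant p a) := by
  have hν1 : -1 < ν := by linarith
  set k := ν + 1 / 2 with hk
  have hk0 : 0 < k := by rw [hk]; linarith
  obtain ⟨C, hC, hCu⟩ := exists_abs_sqrtBesselJ_le hν1
  obtain ⟨D, hD, hDv⟩ := exists_abs_sqrtBesselJ_le (μ := ν + 1) (by linarith)
  set p := min k 1 with hp
  have hp0 : 0 < p := lt_min hk0 one_pos
  have hpow : ∀ z : ℝ, 0 < z → z ≤ 1 → ∀ q : ℝ, k - 1 ≤ q → z ^ q ≤ z ^ (p - 1) :=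
    fun z hz hz1 q hq => Real.rpow_le_rpow_of_exponent_ge hz hz1
      (by have := min_le_left k 1; linarith)
  set A := C + D + k * C + k * D with hA
  have hA0 : 0 < A := by positivity
  have hC1 : ∀ z : ℝ, 0 < z → z ≤ 1 → |sqrtBesselJ ν z| ≤ C * z ^ (p - 1) := fun z hz hz1 =>
    (hCu z hz hz1).trans (mul_le_mul_of_nonneg_left (hpow z hz hz1 _ (by linarith)) hC.le)
  have hD1 : ∀ z : ℝ, 0 < z → z ≤ 1 → |sqrtBesselJ (ν + 1) z| ≤ D * z ^ (p - 1) :=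
    fun z hz hz1 => (hDv z hz hz1).trans
      (mul_le_mul_of_nonneg_left (hpow z hz hz1 _ (by linarith)) hD.le)
  have hC2 : ∀ z : ℝ, 0 < z → z ≤ 1 → |k / z * sqrtBesselJ ν z| ≤ k * C * z ^ (p - 1) := by
    intro z hz hz1
    rw [abs_mul, abs_of_pos (by positivity : 0 < k / z)]
    calc _ ≤ k / z * (C * z ^ k) := by gcongr; exact hCu z hz hz1
      _ = k * C * z ^ (k - 1) := by rw [Real.rpow_sub_one hz.ne']; field_simp
      _ ≤ _ := mul_le_mul_of_nonneg_left (hpow z hz hz1 _ le_rfl) (by positivity)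
  have hD2 : ∀ z : ℝ, 0 < z → z ≤ 1 →
      |k / z * sqrtBesselJ (ν + 1) z| ≤ k * D * z ^ (p - 1) := by
    intro z hz hz1
    rw [abs_mul, abs_of_pos (by positivity : 0 < k / z)]
    calc _ ≤ k / z * (D * z ^ (ν + 1 + 1 / 2)) := by gcongr; exact hDv z hz hz1
      _ = k * D * z ^ (ν + 1 + 1 / 2 - 1) := by rw [Real.rpow_sub_one hz.ne']; field_simp
      _ ≤ _ := mul_le_mul_of_nonneg_left (hpow z hz hz1 _ (by linarith)) (by positivity)
  obtain ⟨α, K, hK, hα1, hα2, hα3⟩ := (isBesselSolution_sqrtBesselJ hν1).exists_amplitude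
    hp0 (min_le_right _ _) hA0
    (fun z hz hz1 => (hC1 z hz hz1).trans (by
      gcongr; rw [hA]; nlinarith [mul_pos hk0 hC, mul_pos hk0 hD]))
    (fun z hz hz1 => (abs_sub _ _).trans (by
      have h1 := hC2 z hz hz1
      have h2 := hD1 z hz hz1
      have : 0 < z ^ (p - 1) := by positivity
      rw [hA]
      nlinarith [mul_pos hC this, mul_pos (mul_pos hk0 hD) this]))
  obtain ⟨β, L, hL, hβ1, hβ2, hβ3⟩ := (isBesselSolution_sqrtBesselJ_succ hν1).exists_amplitude
    hp0 (min_le_right _ _) hA0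
    (fun z hz hz1 => (hD1 z hz hz1).trans (by
      gcongr; rw [hA]; nlinarith [mul_pos hk0 hC, mul_pos hk0 hD]))
    (fun z hz hz1 => (abs_sub _ _).trans (by
      have h1 := hC1 z hz hz1
      have h2 := hD2 z hz hz1
      have : 0 < z ^ (p - 1) := by positivity
      rw [hA]
      nlinarith [mul_pos hD this, mul_pos (mul_pos hk0 hC) this]))
  have scale : ∀ (γ : ℝ → ℂ) (J J' : ℝ), 0 < J → J ≤ J' →
      (∀ a b, 0 < a → a ≤ b → ‖γ b - γ a‖ ≤ J * (varMajorant p b - varMajorant p a)) →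
      ∀ a b, 0 < a → a ≤ b → ‖γ b - γ a‖ ≤ J' * (varMajorant p b - varMajorant p a) := by
    intro γ J J' hJ hJJ hγ a b ha hab
    have h1 := hγ a b ha hab
    have h2 := nonneg_of_mul_nonneg_right ((norm_nonneg _).trans h1) hJ
    exact h1.trans (by gcongr)
  exact ⟨p, α, β, max K L, hp0, lt_max_of_lt_left hK, hα1, hβ1,
    fun z hz => (hα2 z hz).trans (le_max_left _ _), fun z hz => (hβ2 z hz).trans (le_max_right _ _),
    scale α K _ hK (le_max_left _ _) hα3, scale β L _ hL (le_max_right _ _) hβ3⟩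

lemma IsPositiveZerosOfBesselJ.enumeratesZeros {ν : ℝ} {Λ : ℕ → ℝ}
    (h : IsPositiveZerosOfBesselJ ν Λ) : EnumeratesZeros (sqrtBesselJ ν) Λ where
  strictMono := h.1
  pos := h.2.1
  eq_zero n := by rw [sqrtBesselJ, h.2.2.1 n, mul_zero]
  exists_eq z hz hfz := h.2.2.2 z hz
    ((mul_eq_zero.1 hfz).resolve_left (Real.sqrt_pos.2 hz).ne')

lemma phiFB_eq {ν : ℝ} {Λ : ℕ → ℝ} {n : ℕ} {x : ℝ} (hΛ : 0 < Λ n) (hx : 0 < x) :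
    phiFB ν Λ n x = Real.sqrt 2 / (Real.sqrt (Λ n) * |sqrtBesselJ (ν + 1) (Λ n)|) *
      (sqrtBesselJ ν (Λ n * x) * x ^ (-(ν + 1 / 2))) := by
  have hs : 0 < Real.sqrt (Λ n) := Real.sqrt_pos.2 hΛ
  have hsx : 0 < Real.sqrt x := Real.sqrt_pos.2 hx
  have hss : Λ n = Real.sqrt (Λ n) * Real.sqrt (Λ n) := (Real.mul_self_sqrt hΛ.le).symm
  have hxp : x ^ (-ν) = Real.sqrt x * x ^ (-(ν + 1 / 2)) := by
    rw [Real.sqrt_eq_rpow, ← Real.rpow_add hx]; congr 1; ring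
  rw [phiFB, hxp, sqrtBesselJ, sqrtBesselJ, Real.sqrt_mul hΛ.le, abs_mul, abs_mul, abs_of_pos hΛ,
    abs_of_pos hs]
  have e : Real.sqrt (Λ n) * (Real.sqrt (Λ n) * |besselJ (ν + 1) (Λ n)|) =
      Λ n * |besselJ (ν + 1) (Λ n)| := by rw [← mul_assoc, ← hss]
  rw [e]
  ring

lemma hasDerivAt_phiFB {ν : ℝ} (hν : -1 < ν) {Λ : ℕ → ℝ} {n : ℕ} {x : ℝ} (hΛ : 0 < Λ n)
    (hx : 0 < x) :
    HasDerivAt (phiFB ν Λ n) (-(Real.sqrt 2 / (Real.sqrt (Λ n) * |sqrtBesselJ (ν + 1) (Λ n)|) *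
      (Λ n * sqrtBesselJ (ν + 1) (Λ n * x) * x ^ (-(ν + 1 / 2))))) x := by
  have h1 : HasDerivAt (fun x => sqrtBesselJ ν (Λ n * x)) _ x :=
    HasDerivAt.comp x (hasDerivAt_sqrtBesselJ hν (mul_pos hΛ hx))
      ((hasDerivAt_id x).const_mul (Λ n))
  have h2 := (h1.mul (Real.hasDerivAt_rpow_const (p := -(ν + 1 / 2)) (Or.inl hx.ne'))).const_mul
    (Real.sqrt 2 / (Real.sqrt (Λ n) * |sqrtBesselJ (ν + 1) (Λ n)|))
  refine (h2.congr_of_eventuallyEq ?_).congr_deriv ?_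
  · filter_upwards [lt_mem_nhds hx] with w hw
    exact phiFB_eq hΛ hw
  · rw [Real.rpow_sub_one hx.ne', ← mul_neg]
    congr 1
    field_simp
    ring

/-- The terms of the series of `∂𝒫_t(x,y)/∂x`, up to the factor `-2 (x y)^(-ν-1/2)`. -/
noncomputable def besselDerivTerm (ν : ℝ) (Λ : ℕ → ℝ) (t x y : ℝ) (n : ℕ) : ℝ :=
  Real.exp (-t * Λ n) * (sqrtBesselJ (ν + 1) (Λ n) ^ 2)⁻¹ *
    (sqrtBesselJ (ν + 1) (Λ n * x) * sqrtBesselJ ν (Λ n * y))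

lemma exists_bound_sqrtBesselJ {ν : ℝ} (hν : -(1 / 2) < ν) :
    ∃ K : ℝ, 0 < K ∧ ∀ z, 0 < z → |sqrtBesselJ ν z| ≤ K ∧ |sqrtBesselJ (ν + 1) z| ≤ K := by
  obtain ⟨p, α, β, K, -, hK, hα, hβ, hαK, hβK, -, -⟩ := exists_amplitude_sqrtBesselJ hν
  refine ⟨K, hK, fun z hz => ⟨?_, ?_⟩⟩
  · rw [hα]
    refine (Complex.abs_re_le_norm _).trans ?_
    rw [norm_mul, Complex.norm_exp_ofReal_mul_I, mul_one]
    exact hαK z hz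
  · rw [hβ]
    refine (Complex.abs_re_le_norm _).trans ?_
    rw [norm_mul, Complex.norm_exp_ofReal_mul_I, mul_one]
    exact hβK z hz

namespace IsPositiveZerosOfBesselJ

variable {ν : ℝ} {Λ : ℕ → ℝ}

lemma deriv_sq_eq (hΛ : IsPositiveZerosOfBesselJ ν Λ) (n : ℕ) :
    ((ν + 1 / 2) / Λ n * sqrtBesselJ ν (Λ n) - sqrtBesselJ (ν + 1) (Λ n)) ^ 2 =
      sqrtBesselJ (ν + 1) (Λ n) ^ 2 := by
  rw [hΛ.enumeratesZeros.eq_zero n]; ring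

lemma hasVariationBound_inv_sq (hν : -(1 / 2) < ν) (hΛ : IsPositiveZerosOfBesselJ ν Λ) :
    ∃ K : ℝ, HasVariationBound K fun n => (((sqrtBesselJ (ν + 1) (Λ n) ^ 2)⁻¹ : ℝ) : ℂ) := by
  obtain ⟨K, -, hK1, hK2⟩ := (isBesselSolution_sqrtBesselJ
    (by linarith : -1 < ν)).exists_sum_abs_inv_sq_deriv_le hΛ.enumeratesZeros
  simp only [hΛ.deriv_sq_eq] at hK1 hK2
  refine ⟨K, fun n => ?_, fun N => ?_⟩
  · rw [Complex.norm_real]; exact hK1 n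
  · simp_rw [← Complex.ofReal_sub, Complex.norm_real]; exact hK2 N

lemma exists_sum_besselDerivTerm_mul_abs_sub_le (hν : -(1 / 2) < ν)
    (hΛ : IsPositiveZerosOfBesselJ ν Λ) :
    ∃ C : ℝ, 0 < C ∧ ∀ t x y : ℝ, 0 < t → x ∈ Ioo (0 : ℝ) 1 → y ∈ Ioo (0 : ℝ) 1 → ∀ N,
      |∑ n ∈ Finset.range N, besselDerivTerm ν Λ t x y n| * |x - y| ≤ C := by
  obtain ⟨p, α, β, K, hp, hK, hα, hβ, hαK, hβK, hαv, hβv⟩ := exists_amplitude_sqrtBesselJ hν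
  obtain ⟨L, hL⟩ := hΛ.hasVariationBound_inv_sq hν
  have hgap := (isBesselSolution_sqrtBesselJ (by linarith : -1 < ν)).summable_gap_sub_pi
    hΛ.enumeratesZeros
  set S := ∑' n, |Λ (n + 1) - Λ n - Real.pi| with hS
  have hS0 : 0 ≤ S := tsum_nonneg fun _ => abs_nonneg _
  set M := 2 * (2 * 1 * L) * (2 * K * K) with hM
  have hM0 : 0 ≤ M := by have := hL.nonneg; positivity
  refine ⟨6 * M * (1 + 2 * S) + 1, by positivity, fun t x y ht hx hy N => ?_⟩
  have hexp : HasVariationBound 1 fun n => ((Real.exp (-t * Λ n) : ℝ) : ℂ) := by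
    refine .of_antitone (fun m n hmn => ?_) (fun n => (Real.exp_pos _).le) ?_
    · have := hΛ.1.monotone hmn
      exact Real.exp_le_exp.2 (by nlinarith)
    · exact Real.exp_le_one_iff.2 (by have := hΛ.2.1 0; nlinarith)
  have hβx : HasVariationBound K fun n => β (Λ n * x) :=
    .comp_dilation hp.le hβK hβv hΛ.1.monotone hΛ.2.1 hx.1
  have hαy : HasVariationBound K fun n => α (Λ n * y) :=
    .comp_dilation hp.le hαK hαv hΛ.1.monotone hΛ.2.1 hy.1
  have hplus := (hexp.mul hL).mul (hβx.mul hαy)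
  have hminus := (hexp.mul hL).mul (hβx.mul hαy.conj)
  have key : ∀ (b : ℕ → ℂ) (w : ℝ), HasVariationBound M b → |w| ≤ 2 →
      |x - y| ≤ |Real.sin (Real.pi * w / 2)| →
      ‖∑ n ∈ Finset.range N, b n * Complex.exp ((Λ n * w : ℝ) * Complex.I)‖ * |x - y| ≤
        3 * M * (1 + 2 * S) := by
    intro b w hb hw hsin
    have h1 := hb.norm_sum_mul_exp_le hgap hw N
    have h2 := mul_le_mul_of_nonneg_left hsin
      (norm_nonneg (∑ n ∈ Finset.range N, b n * Complex.exp ((Λ n * w : ℝ) * Complex.I)))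
    linarith
  have kplus := key _ (x + y) hplus
    (by rw [abs_of_pos (by linarith [hx.1, hy.1])]; linarith [hx.2, hy.2])
    (abs_le_abs_sin_half_pi_mul (by linarith [hx.1, hy.1])
      (abs_le.2 ⟨by linarith [hx.1], by linarith [hy.1]⟩)
      (abs_le.2 ⟨by linarith [hy.2], by linarith [hx.2]⟩) (by linarith [hx.2, hy.2]))
  have hxy : |x - y| ≤ 1 := abs_le.2 ⟨by linarith [hx.1, hy.2], by linarith [hx.2, hy.1]⟩
  have hsin : |x - y| ≤ |Real.sin (Real.pi * (x - y) / 2)| := by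
    have h1 := abs_le_abs_sin_half_pi_mul (abs_nonneg (x - y)) le_rfl (by linarith) (by linarith)
    rcases abs_cases (x - y) with ⟨he, -⟩ | ⟨he, -⟩
    · rwa [he] at h1 ⊢
    · rw [he] at h1 ⊢
      rwa [mul_neg, neg_div, Real.sin_neg, abs_neg] at h1
  have kminus := key _ (x - y) hminus (by linarith) hsin
  set Sp := ∑ n ∈ Finset.range N, ((Real.exp (-t * Λ n) : ℝ) : ℂ) *
    (((sqrtBesselJ (ν + 1) (Λ n) ^ 2)⁻¹ : ℝ) : ℂ) * (β (Λ n * x) * α (Λ n * y)) *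
    Complex.exp ((Λ n * (x + y) : ℝ) * Complex.I) with hSp
  set Sm := ∑ n ∈ Finset.range N, ((Real.exp (-t * Λ n) : ℝ) : ℂ) *
    (((sqrtBesselJ (ν + 1) (Λ n) ^ 2)⁻¹ : ℝ) : ℂ) *
    (β (Λ n * x) * (starRingEnd ℂ) (α (Λ n * y))) *
    Complex.exp ((Λ n * (x - y) : ℝ) * Complex.I) with hSm
  have hsum : ∑ n ∈ Finset.range N, besselDerivTerm ν Λ t x y n = (Sp.re + Sm.re) / 2 := by
    rw [← Complex.add_re, hSp, hSm, ← Finset.sum_add_distrib, Complex.re_sum, Finset.sum_div]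
    refine Finset.sum_congr rfl fun n _ => ?_
    have e1 : Complex.exp ((Λ n * (x + y) : ℝ) * Complex.I) =
        Complex.exp ((Λ n * x : ℝ) * Complex.I) * Complex.exp ((Λ n * y : ℝ) * Complex.I) := by
      rw [← Complex.exp_add]; congr 1; push_cast; ring
    have e2 : Complex.exp ((Λ n * (x - y) : ℝ) * Complex.I) =
        Complex.exp ((Λ n * x : ℝ) * Complex.I) *
          (starRingEnd ℂ) (Complex.exp ((Λ n * y : ℝ) * Complex.I)) := by
      rw [← Complex.exp_conj, map_mul, Complex.conj_ofReal, Complex.conj_I, ← Complex.exp_add]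
      congr 1; push_cast; ring
    rw [besselDerivTerm, hβ (Λ n * x), hα, re_mul_re_eq, ← Complex.add_re, mul_div_assoc',
      ← Complex.re_ofReal_mul, e1, e2, map_mul]
    congr 2
    push_cast
    ring
  have habs : |∑ n ∈ Finset.range N, besselDerivTerm ν Λ t x y n| ≤ ‖Sp‖ + ‖Sm‖ := by
    rw [hsum, abs_div, abs_two]
    have h1 := abs_add_le Sp.re Sm.re
    have h2 := Complex.abs_re_le_norm Sp
    have h3 := Complex.abs_re_le_norm Sm
    have h4 := norm_nonneg Sp
    have h5 := norm_nonneg Sm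
    linarith
  have := mul_le_mul_of_nonneg_right habs (abs_nonneg (x - y))
  linarith

lemma exists_inv_sq_le (hν : -(1 / 2) < ν) (hΛ : IsPositiveZerosOfBesselJ ν Λ) :
    ∃ K : ℝ, 0 < K ∧ ∀ n, (sqrtBesselJ (ν + 1) (Λ n) ^ 2)⁻¹ ≤ K := by
  obtain ⟨K, hK, hK1, -⟩ := (isBesselSolution_sqrtBesselJ
    (by linarith : -1 < ν)).exists_sum_abs_inv_sq_deriv_le hΛ.enumeratesZeros
  simp only [hΛ.deriv_sq_eq] at hK1
  exact ⟨K, hK, fun n => (le_abs_self _).trans (hK1 n)⟩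

lemma exists_abs_besselDerivTerm_le (hν : -(1 / 2) < ν) (hΛ : IsPositiveZerosOfBesselJ ν Λ) :
    ∃ K g : ℝ, 0 < K ∧ 0 < g ∧ ∀ t x y : ℝ, 0 < t → 0 < x → 0 < y → ∀ n : ℕ,
      |besselDerivTerm ν Λ t x y n| ≤ K * Real.exp (-(t * g) * (n + 1)) := by
  obtain ⟨B, hB, hBu⟩ := exists_bound_sqrtBesselJ hν
  obtain ⟨K, hK, hKn⟩ := hΛ.exists_inv_sq_le hν
  obtain ⟨g, hg, hgn⟩ := (isBesselSolution_sqrtBesselJ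
    (by linarith : -1 < ν)).exists_linear_growth_zeros hΛ.enumeratesZeros
  refine ⟨K * (B * B), g, by positivity, hg, fun t x y ht hx hy n => ?_⟩
  have h1 := (hBu (Λ n * x) (mul_pos (hΛ.2.1 n) hx)).2
  have h2 := (hBu (Λ n * y) (mul_pos (hΛ.2.1 n) hy)).1
  have h3 : Real.exp (-t * Λ n) ≤ Real.exp (-(t * g) * (n + 1)) :=
    Real.exp_le_exp.2 (by nlinarith [hgn n])
  have h4 := hKn n
  rw [besselDerivTerm, abs_mul, abs_mul, abs_mul, Real.abs_exp,
    abs_of_nonneg (by positivity : 0 ≤ (sqrtBesselJ (ν + 1) (Λ n) ^ 2)⁻¹)]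
  calc _ ≤ Real.exp (-(t * g) * (n + 1)) * K * (B * B) := by gcongr
    _ = _ := by ring

lemma summable_besselDerivTerm (hν : -(1 / 2) < ν) (hΛ : IsPositiveZerosOfBesselJ ν Λ)
    {t x y : ℝ} (ht : 0 < t) (hx : 0 < x) (hy : 0 < y) :
    Summable (besselDerivTerm ν Λ t x y) := by
  obtain ⟨K, g, hK, hg, hKg⟩ := hΛ.exists_abs_besselDerivTerm_le hν
  exact Summable.of_norm_bounded ((tsum_exp_neg_le (mul_pos ht hg)).1.mul_left K)
    (hKg t x y ht hx hy)

lemma exists_abs_tsum_besselDerivTerm_le (hν : -(1 / 2) < ν)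
    (hΛ : IsPositiveZerosOfBesselJ ν Λ) :
    ∃ C : ℝ, 0 < C ∧ ∀ t x y : ℝ, 0 < t → x ∈ Ioo (0 : ℝ) 1 → y ∈ Ioo (0 : ℝ) 1 →
      |∑' n, besselDerivTerm ν Λ t x y n| * (t ^ 2 + |x - y| ^ 2) ≤ C := by
  obtain ⟨C, hC, hCN⟩ := hΛ.exists_sum_besselDerivTerm_mul_abs_sub_le hν
  obtain ⟨K, g, hK, hg, hKg⟩ := hΛ.exists_abs_besselDerivTerm_le hν
  refine ⟨K * (2 / g ^ 2) + C, by positivity, fun t x y ht hx hy => ?_⟩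
  have hsum := hΛ.summable_besselDerivTerm hν ht hx.1 hy.1
  have h1 : |∑' n, besselDerivTerm ν Λ t x y n| * |x - y| ≤ C :=
    le_of_tendsto (hsum.hasSum.tendsto_sum_nat.abs.mul_const _)
      (Eventually.of_forall (hCN t x y ht hx hy))
  have h2 : |∑' n, besselDerivTerm ν Λ t x y n| * t ^ 2 ≤ K * (2 / g ^ 2) := by
    obtain ⟨hs, hle⟩ := tsum_exp_neg_le (mul_pos ht hg)
    have := tsum_of_norm_bounded (f := besselDerivTerm ν Λ t x y) (hs.mul_left K).hasSum
      (hKg t x y ht hx.1 hy.1)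
    rw [tsum_mul_left, Real.norm_eq_abs] at this
    calc _ ≤ K * (2 / (t * g) ^ 2) * t ^ 2 := by gcongr; exact this.trans (by gcongr)
      _ = _ := by field_simp
  have hxy : |x - y| ≤ 1 := abs_le.2 ⟨by linarith [hx.1, hy.2], by linarith [hx.2, hy.1]⟩
  have h3 : |x - y| ^ 2 ≤ |x - y| := by nlinarith [abs_nonneg (x - y)]
  have := mul_le_mul_of_nonneg_left h3 (abs_nonneg (∑' n, besselDerivTerm ν Λ t x y n))
  linarith

lemma normalization_sq {n : ℕ} (hΛ : 0 < Λ n) :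
    (Real.sqrt 2 / (Real.sqrt (Λ n) * |sqrtBesselJ (ν + 1) (Λ n)|)) ^ 2 =
      2 / Λ n * (sqrtBesselJ (ν + 1) (Λ n) ^ 2)⁻¹ := by
  rw [div_pow, mul_pow, Real.sq_sqrt zero_le_two, Real.sq_sqrt hΛ.le, sq_abs, div_mul_eq_div_div,
    div_eq_mul_inv (2 / Λ n)]

lemma hasDerivAt_pKer_term (hν : -1 < ν) (hΛ : IsPositiveZerosOfBesselJ ν Λ) (t : ℝ) {x y : ℝ}
    (hx : 0 < x) (hy : 0 < y) (n : ℕ) :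
    HasDerivAt (fun x' => Real.exp (-t * Λ n) * phiFB ν Λ n x' * phiFB ν Λ n y)
      (-2 * (x * y) ^ (-ν - 1 / 2) * besselDerivTerm ν Λ t x y n) x := by
  have h0 := hΛ.2.1 n
  refine (((hasDerivAt_phiFB hν h0 hx).const_mul _).mul_const _).congr_deriv ?_
  rw [phiFB_eq h0 hy, Real.mul_rpow hx.le hy.le, besselDerivTerm,
    show -ν - 1 / 2 = -(ν + 1 / 2) by ring]
  have e := normalization_sq (ν := ν) h0
  set d := Real.sqrt 2 / (Real.sqrt (Λ n) * |sqrtBesselJ (ν + 1) (Λ n)|)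
  have e' : d ^ 2 * Λ n = 2 * (sqrtBesselJ (ν + 1) (Λ n) ^ 2)⁻¹ := by rw [e]; field_simp
  linear_combination -(Real.exp (-t * Λ n) * sqrtBesselJ (ν + 1) (Λ n * x) *
    sqrtBesselJ ν (Λ n * y) * x ^ (-(ν + 1 / 2)) * y ^ (-(ν + 1 / 2))) * e'

lemma summable_pKer_term (hν : -(1 / 2) < ν) (hΛ : IsPositiveZerosOfBesselJ ν Λ) {t x y : ℝ}
    (ht : 0 < t) (hx : 0 < x) (hy : 0 < y) :
    Summable fun n => Real.exp (-t * Λ n) * phiFB ν Λ n x * phiFB ν Λ n y := by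
  obtain ⟨B, hB, hBu⟩ := exists_bound_sqrtBesselJ hν
  obtain ⟨K, hK, hKn⟩ := hΛ.exists_inv_sq_le hν
  obtain ⟨g, hg, hgn⟩ := (isBesselSolution_sqrtBesselJ
    (by linarith : -1 < ν)).exists_linear_growth_zeros hΛ.enumeratesZeros
  refine Summable.of_norm_bounded ((tsum_exp_neg_le (mul_pos ht hg)).1.mul_left
    (2 / Λ 0 * K * (B * B) * (x ^ (-(ν + 1 / 2)) * y ^ (-(ν + 1 / 2))))) fun n => ?_
  have h00 := hΛ.2.1 0
  have h0 := hΛ.2.1 n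
  have h1 := (hBu (Λ n * x) (mul_pos h0 hx)).1
  have h2 := (hBu (Λ n * y) (mul_pos h0 hy)).1
  have h3 : Real.exp (-t * Λ n) ≤ Real.exp (-(t * g) * (n + 1)) :=
    Real.exp_le_exp.2 (by nlinarith [hgn n])
  have h4 := hKn n
  have h5 : Λ 0 ≤ Λ n := hΛ.1.monotone n.zero_le
  have e := normalization_sq (ν := ν) h0
  rw [phiFB_eq h0 hy, phiFB_eq h0 hx]
  set d := Real.sqrt 2 / (Real.sqrt (Λ n) * |sqrtBesselJ (ν + 1) (Λ n)|)
  have hxp : 0 < x ^ (-(ν + 1 / 2)) := by positivity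
  have hyp : 0 < y ^ (-(ν + 1 / 2)) := by positivity
  calc _ = d ^ 2 * (|sqrtBesselJ ν (Λ n * x)| * |sqrtBesselJ ν (Λ n * y)|) *
        (x ^ (-(ν + 1 / 2)) * y ^ (-(ν + 1 / 2))) * Real.exp (-t * Λ n) := by
        rw [Real.norm_eq_abs]
        simp only [abs_mul, Real.abs_exp, abs_of_pos hxp, abs_of_pos hyp]
        rw [← sq_abs d]
        ring
    _ ≤ _ := by rw [e]; gcongr

lemma hasDerivAt_pKer (hν : -(1 / 2) < ν) (hΛ : IsPositiveZerosOfBesselJ ν Λ) {t x y : ℝ}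
    (ht : 0 < t) (hx : 0 < x) (hy : 0 < y) :
    HasDerivAt (fun x' => pKer ν Λ t x' y)
      (-2 * (x * y) ^ (-ν - 1 / 2) * ∑' n, besselDerivTerm ν Λ t x y n) x := by
  obtain ⟨K, g, hK, hg, hKg⟩ := hΛ.exists_abs_besselDerivTerm_le hν
  have hx2 : x / 2 < x := half_lt_self hx
  rw [← tsum_mul_left]
  refine hasDerivAt_tsum_of_isPreconnected
    (u := fun n : ℕ => 2 * (x / 2 * y) ^ (-ν - 1 / 2) *
      (K * Real.exp (-(t * g) * (n + 1))))
    (((tsum_exp_neg_le (mul_pos ht hg)).1.mul_left K).mul_left _) isOpen_Ioi isPreconnected_Ioi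
    (g := fun n x' => Real.exp (-t * Λ n) * phiFB ν Λ n x' * phiFB ν Λ n y)
    (g' := fun n x' => -2 * (x' * y) ^ (-ν - 1 / 2) * besselDerivTerm ν Λ t x' y n)
    (fun n w hw => hΛ.hasDerivAt_pKer_term (by linarith) t ((half_pos hx).trans hw) hy n)
    (fun n w hw => ?_) (mem_Ioi.2 hx2) (hΛ.summable_pKer_term hν ht hx hy) (mem_Ioi.2 hx2)
  have hw0 : 0 < w := (half_pos hx).trans hw
  have h1 := hKg t w y ht hw0 hy n
  have h2 : (w * y) ^ (-ν - 1 / 2) ≤ (x / 2 * y) ^ (-ν - 1 / 2) :=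
    Real.rpow_le_rpow_of_nonpos (by positivity)
      (mul_le_mul_of_nonneg_right (mem_Ioi.1 hw).le hy.le) (by linarith)
  have h3 : 0 < (w * y) ^ (-ν - 1 / 2) := by positivity
  rw [Real.norm_eq_abs, abs_mul, abs_mul, abs_neg, abs_two, abs_of_pos h3]
  gcongr

end IsPositiveZerosOfBesselJ

/-- Estimate for `∂𝒫_t(x,y)/∂x` (Lemma 2.2). -/
theorem poissonKernel_deriv_estimate (ν : ℝ) (hν : -(1/2 : ℝ) < ν)
    (Λ : ℕ → ℝ) (hΛ : IsPositiveZerosOfBesselJ ν Λ) :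
    ∃ C : ℝ, 0 < C ∧
      ∀ t x y : ℝ, 0 < t → x ∈ Ioo (0:ℝ) 1 → y ∈ Ioo (0:ℝ) 1 →
        ∃ d : ℝ, HasDerivAt (fun x' => pKer ν Λ t x' y) d x ∧
          |d| ≤ C * (x * y) ^ (-ν - 1/2) / (t^2 + |x - y|^2) := by
  obtain ⟨C, hC, hCt⟩ := hΛ.exists_abs_tsum_besselDerivTerm_le hν
  refine ⟨2 * C, by positivity, fun t x y ht hx hy =>
    ⟨_, hΛ.hasDerivAt_pKer hν ht hx.1 hy.1, ?_⟩⟩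
  have hxy : 0 < (x * y) ^ (-ν - 1 / 2) := by have := hx.1; have := hy.1; positivity
  rw [le_div_iff₀ (by positivity), abs_mul, abs_mul, abs_neg, abs_two, abs_of_pos hxy, mul_assoc]
  calc _ ≤ 2 * (x * y) ^ (-ν - 1 / 2) * C := by gcongr; exact hCt t x y ht hx hy
    _ = _ := by ring
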